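/- arXiv:1009.4549 — 2 statements merged into one kernel-verified Lean document; each statement's English description precedes it below -/
import Mathlib

section
/- Let μ ∈ ℝ with μ ∉ {−1,−2,−3,…}, let ν ∈ ℝ and j ∈ ℕ₀. Then there exist nonzero real constants C₁ and C₂ (depending on μ, ν, j) such that, as x → ∞, x^{(ν+1)/2−j}·e^{−x}·Λ_{1,j}^{μ,ν}(x) − C₁ = O(1/x) and x^{(ν+1)/2−j}·e^{x}·Λ_{2,j}^{μ,ν}(x) − C₂ = O(1/x); in particular Λ_{1,j}^{μ,ν}(x) grows like C₁·x^{j−(ν+1)/2}·e^{x} and Λ_{2,j}^{μ,ν}(x) decays like C₂·x^{j−(ν+1)/2}·e^{−x}. -/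
noncomputable section

open Set MeasureTheory Filter Topology

/-- The Euler operator `θ = x·d/dx` acting on real-valued functions on `ℝ`. -/
def eulerOp (u : ℝ → ℝ) : ℝ → ℝ := fun x => x * deriv u x

/-- The operator `(θ + a)(θ + b) − x²` applied to `v`. -/
def quadOp (a b : ℝ) (v : ℝ → ℝ) : ℝ → ℝ := fun x =>
  eulerOp (fun y => eulerOp v y + b * v y) x
    + a * (eulerOp v x + b * v x) - x ^ 2 * v x

/-- The fourth-order operator `D_{μ,ν} = x⁻²((θ+μ+ν)(θ+μ) − x²)(θ(θ+ν) − x²)`. -/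
def Dop (μ ν : ℝ) (u : ℝ → ℝ) : ℝ → ℝ := fun x =>
  quadOp (μ + ν) μ (quadOp 0 ν u) x / x ^ 2

/-- The normalized I-Bessel function `Ĩ_α(z) = Σ (z/2)^{2n}/(n!·Γ(n+α+1))`. -/
def tildeI (α z : ℝ) : ℝ :=
  ∑' n : ℕ, (z / 2) ^ (2 * n) / ((n.factorial : ℝ) * Real.Gamma ((n : ℝ) + α + 1))

/-- The K-Bessel function `K_α(z) = ∫₀^∞ e^{−z·cosh s}·cosh(α·s) ds`. -/
def besselK (α z : ℝ) : ℝ :=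
  ∫ s in Ioi (0 : ℝ), Real.exp (-z * Real.cosh s) * Real.cosh (α * s)

/-- The normalized K-Bessel function `K̃_α(z) = (z/2)^{−α}·K_α(z)`. -/
def tildeK (α z : ℝ) : ℝ := (z / 2) ^ (-α) * besselK α z

/-- The generating function `G₁^{μ,ν}(t,x)`. -/
def genG₁ (μ ν t x : ℝ) : ℝ :=
  (1 - t) ^ (-(μ + ν + 2) / 2) * tildeI (μ / 2) (t * x / (1 - t)) * tildeI (ν / 2) (x / (1 - t))

/-- The generating function `G₂^{μ,ν}(t,x)`. -/
def genG₂ (μ ν t x : ℝ) : ℝ :=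
  (1 - t) ^ (-(μ + ν + 2) / 2) * tildeI (μ / 2) (t * x / (1 - t)) * tildeK (ν / 2) (x / (1 - t))

/-- The generating function `G₃^{μ,ν}(t,x)`. -/
def genG₃ (μ ν t x : ℝ) : ℝ :=
  (1 - t) ^ (-(μ + ν + 2) / 2) * tildeK (μ / 2) (t * x / (1 - t)) * tildeI (ν / 2) (x / (1 - t))

/-- The generating function `G₄^{μ,ν}(t,x)`. -/
def genG₄ (μ ν t x : ℝ) : ℝ :=
  (1 - t) ^ (-(μ + ν + 2) / 2) * tildeK (μ / 2) (t * x / (1 - t)) * tildeK (ν / 2) (x / (1 - t))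

/-- `Λ₁ⱼ^{μ,ν}(x) = (1/j!)·(∂/∂t)^j|₀ G₁^{μ,ν}(t,x)`. -/
def Lambda₁ (μ ν : ℝ) (j : ℕ) (x : ℝ) : ℝ :=
  iteratedDeriv j (fun t => genG₁ μ ν t x) 0 / (j.factorial : ℝ)

/-- `Λ₂ⱼ^{μ,ν}(x) = (1/j!)·(∂/∂t)^j|₀ G₂^{μ,ν}(t,x)`. -/
def Lambda₂ (μ ν : ℝ) (j : ℕ) (x : ℝ) : ℝ :=
  iteratedDeriv j (fun t => genG₂ μ ν t x) 0 / (j.factorial : ℝ)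

/-- `Λ₁ⱼ` for integer `j`, vanishing for `j < 0`. -/
def Lambda₁Z (μ ν : ℝ) (j : ℤ) (x : ℝ) : ℝ :=
  if 0 ≤ j then Lambda₁ μ ν j.toNat x else 0

/-- `Λ₂ⱼ` for integer `j`, vanishing for `j < 0`. -/
def Lambda₂Z (μ ν : ℝ) (j : ℤ) (x : ℝ) : ℝ :=
  if 0 ≤ j then Lambda₂ μ ν j.toNat x else 0

/-- For `μ = m` a positive odd integer, `Λ₃ⱼ^{μ,ν}(x) = (1/(j+μ)!)·(∂/∂t)^{j+μ}|₀ [tᵐ·G₃]`,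
the derivative at `0` being the limit from the right of the `(j+μ)`-th derivative of the
real-analytic function `t ↦ tᵐ·G₃^{m,ν}(t,x)` on `(0,1)`; it vanishes for `j < −μ`. -/
def Lambda₃ (m : ℕ) (ν : ℝ) (j : ℤ) (x : ℝ) : ℝ :=
  if -(m : ℤ) ≤ j then
    limUnder (𝓝[>] (0 : ℝ))
        (fun t => iteratedDeriv (j + (m : ℤ)).toNat (fun s => s ^ m * genG₃ (m : ℝ) ν s x) t) /
      (((j + (m : ℤ)).toNat.factorial : ℝ))
  else 0

/-- For `μ = m` a positive odd integer, `Λ₄ⱼ^{μ,ν}(x) = (1/(j+μ)!)·(∂/∂t)^{j+μ}|₀ [tᵐ·G₄]`,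
vanishing for `j < −μ`. -/
def Lambda₄ (m : ℕ) (ν : ℝ) (j : ℤ) (x : ℝ) : ℝ :=
  if -(m : ℤ) ≤ j then
    limUnder (𝓝[>] (0 : ℝ))
        (fun t => iteratedDeriv (j + (m : ℤ)).toNat (fun s => s ^ m * genG₄ (m : ℝ) ν s x) t) /
      (((j + (m : ℤ)).toNat.factorial : ℝ))
  else 0

/-! ### The power series of the normalized I-Bessel function -/

/-- The coefficient `1 / (n!·Γ(n+α+1))` of the series defining `Ĩ_α`. -/
def tildeICoeff (α : ℝ) (n : ℕ) : ℝ :=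
  ((n.factorial : ℝ) * Real.Gamma ((n : ℝ) + α + 1))⁻¹

lemma inv_Gamma_eq (s : ℝ) : (Real.Gamma s)⁻¹ = s * (Real.Gamma (s + 1))⁻¹ := by
  by_cases hs : s = 0
  · simp [hs, Real.Gamma_zero]
  · rw [Real.Gamma_add_one hs, mul_inv]
    field_simp

lemma succ_mul_tildeICoeff_succ (α : ℝ) (n : ℕ) :
    ((n : ℝ) + 1) * tildeICoeff α (n + 1) = tildeICoeff (α + 1) n := by
  unfold tildeICoeff
  rw [Nat.factorial_succ]
  push_cast
  rw [show (n : ℝ) + 1 + α + 1 = n + (α + 1) + 1 by ring, mul_inv, mul_inv, mul_inv]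
  have : (n : ℝ) + 1 ≠ 0 := by positivity
  field_simp

lemma tildeICoeff_eq (α : ℝ) (n : ℕ) :
    tildeICoeff α n = ((n : ℝ) + α + 1) * tildeICoeff (α + 1) n := by
  unfold tildeICoeff
  rw [mul_inv, mul_inv, inv_Gamma_eq, show (n : ℝ) + (α + 1) + 1 = n + α + 1 + 1 by ring]
  ring

lemma exists_abs_tildeICoeff_le (α : ℝ) :
    ∃ C : ℝ, ∀ n : ℕ, |tildeICoeff α n| ≤ C * (n.factorial : ℝ)⁻¹ := by
  obtain ⟨N, hN⟩ := exists_nat_ge (-α)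
  set g : ℕ → ℝ := fun n => |(Real.Gamma ((n : ℝ) + α + 1))⁻¹| with hg
  have hstep : ∀ n, N ≤ n → g (n + 1) ≤ g n := by
    intro n hn
    have hn' : (N : ℝ) ≤ n := by exact_mod_cast hn
    have h1 : 1 ≤ (n : ℝ) + α + 1 := by linarith
    simp only [hg]
    rw [inv_Gamma_eq ((n : ℝ) + α + 1), abs_mul, abs_of_nonneg (by linarith : 0 ≤ (n : ℝ) + α + 1)]
    push_cast
    rw [show (n : ℝ) + 1 + α + 1 = n + α + 1 + 1 by ring]
    exact le_mul_of_one_le_left (abs_nonneg _) h1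
  have htail : ∀ n, N ≤ n → g n ≤ g N := by
    intro n hn
    induction n, hn using Nat.le_induction with
    | base => exact le_rfl
    | succ n hn ih => exact (hstep n hn).trans ih
  refine ⟨∑ i ∈ Finset.range (N + 1), g i, fun n => ?_⟩
  have hbound : g n ≤ ∑ i ∈ Finset.range (N + 1), g i := by
    have hnn : ∀ i ∈ Finset.range (N + 1), 0 ≤ g i := fun i _ => abs_nonneg _
    rcases le_total n N with h | h
    · exact Finset.single_le_sum hnn (Finset.mem_range.2 (by omega))
    · exact (htail n h).trans (Finset.single_le_sum hnn (Finset.mem_range.2 (by omega)))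
  unfold tildeICoeff
  rw [mul_inv, abs_mul, mul_comm, abs_of_nonneg (by positivity : 0 ≤ ((n.factorial : ℝ))⁻¹)]
  gcongr

lemma summable_abs_tildeICoeff (α : ℝ) {r : ℝ} (hr : 0 ≤ r) :
    Summable fun n : ℕ => r ^ n * |tildeICoeff α n| := by
  obtain ⟨C, hC⟩ := exists_abs_tildeICoeff_le α
  refine Summable.of_nonneg_of_le (fun n => by positivity) (fun n => ?_)
    ((Real.summable_pow_div_factorial r).mul_left C)
  calc r ^ n * |tildeICoeff α n| ≤ r ^ n * (C * (n.factorial : ℝ)⁻¹) := by gcongr; exact hC n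
    _ = C * (r ^ n / n.factorial) := by ring

lemma summable_tildeICoeff (α y : ℝ) : Summable fun n : ℕ => y ^ n * tildeICoeff α n := by
  refine Summable.of_norm ?_
  simpa [abs_mul, abs_pow] using summable_abs_tildeICoeff α (abs_nonneg y)

/-- The series of `Ĩ_α` as a function of `y = (z/2)²`. -/
def tildeISeries (α y : ℝ) : ℝ := ∑' n : ℕ, y ^ n * tildeICoeff α n

lemma tildeI_eq_tildeISeries (α z : ℝ) : tildeI α z = tildeISeries α ((z / 2) ^ 2) := by
  unfold tildeI tildeISeries tildeICoeff
  exact tsum_congr fun n => by rw [pow_mul, div_eq_mul_inv]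

lemma natCast_mul_tildeICoeff (α y : ℝ) (n : ℕ) :
    ((n + 1 : ℕ) : ℝ) * y ^ (n + 1 - 1) * tildeICoeff α (n + 1)
      = y ^ n * tildeICoeff (α + 1) n := by
  rw [← succ_mul_tildeICoeff_succ]
  push_cast
  ring

lemma hasDerivAt_tildeISeries (α y : ℝ) :
    HasDerivAt (tildeISeries α) (tildeISeries (α + 1) y) y := by
  set R : ℝ := |y| + 1
  have hR : 0 ≤ R := by positivity
  have hu : Summable fun n : ℕ => (n : ℝ) * R ^ (n - 1) * |tildeICoeff α n| := by
    rw [← summable_nat_add_iff 1]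
    refine (summable_abs_tildeICoeff (α + 1) hR).congr fun n => ?_
    have h := congrArg abs (natCast_mul_tildeICoeff α R n)
    rw [abs_mul, abs_mul, abs_mul, abs_of_nonneg (by positivity : (0 : ℝ) ≤ R ^ (n + 1 - 1)),
      abs_of_nonneg (by positivity : (0 : ℝ) ≤ R ^ n),
      abs_of_nonneg (by positivity : (0 : ℝ) ≤ ((n + 1 : ℕ) : ℝ))] at h
    exact h.symm
  have hmem : y ∈ Metric.ball (0 : ℝ) R := by
    simp only [Metric.mem_ball, dist_zero_right, Real.norm_eq_abs, R]
    linarith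
  have hle : ∀ (n : ℕ), ∀ w ∈ Metric.ball (0 : ℝ) R,
      ‖(n : ℝ) * w ^ (n - 1) * tildeICoeff α n‖ ≤ (n : ℝ) * R ^ (n - 1) * |tildeICoeff α n| := by
    intro n w hw
    rw [Metric.mem_ball, dist_zero_right, Real.norm_eq_abs] at hw
    rw [Real.norm_eq_abs, abs_mul, abs_mul, abs_pow, Nat.abs_cast]
    gcongr
  have h := hasDerivAt_tsum_of_isPreconnected hu Metric.isOpen_ball
    (convex_ball (0 : ℝ) R).isPreconnected
    (fun n w _ => (hasDerivAt_pow n w).mul_const (tildeICoeff α n)) hle hmem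
    (summable_tildeICoeff α y) hmem
  have hs : Summable fun n : ℕ => (n : ℝ) * y ^ (n - 1) * tildeICoeff α n :=
    Summable.of_norm_bounded hu fun n => hle n y hmem
  rw [hs.tsum_eq_zero_add] at h
  simp only [natCast_mul_tildeICoeff, Nat.cast_zero, zero_mul, zero_add] at h
  exact h

lemma tildeISeries_recurrence (α y : ℝ) :
    tildeISeries α y = (α + 1) * tildeISeries (α + 1) y + y * tildeISeries (α + 2) y := by
  have h2 : HasSum (fun n : ℕ => (n : ℝ) * (y ^ n * tildeICoeff (α + 1) n))
      (y * tildeISeries (α + 2) y) := by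
    rw [← hasSum_nat_add_iff' 1]
    simp only [Finset.range_one, Finset.sum_singleton, Nat.cast_zero, zero_mul, sub_zero]
    refine ((summable_tildeICoeff (α + 2) y).hasSum.mul_left y).congr_fun fun n => ?_
    rw [show α + 2 = α + 1 + 1 by ring, ← succ_mul_tildeICoeff_succ (α + 1)]
    push_cast
    ring
  have h1 := ((summable_tildeICoeff (α + 1) y).hasSum.mul_left (α + 1)).add h2
  refine HasSum.tsum_eq (h1.congr_fun fun n => ?_)
  rw [tildeICoeff_eq α n]
  ring

lemma hasDerivAt_tildeI (α z : ℝ) :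
    HasDerivAt (tildeI α) (z / 2 * tildeI (α + 1) z) z := by
  have h1 : HasDerivAt (fun w : ℝ => (w / 2) ^ 2) (z / 2) z := by
    have := ((hasDerivAt_id z).div_const 2).pow 2
    refine this.congr_deriv ?_
    simp
    ring
  have h2 := (hasDerivAt_tildeISeries α ((z / 2) ^ 2)).comp z h1
  rw [tildeI_eq_tildeISeries (α + 1), mul_comm]
  exact h2.congr_of_eventuallyEq (Eventually.of_forall fun w => tildeI_eq_tildeISeries α w)

lemma tildeI_recurrence (α z : ℝ) :
    tildeI α z = (α + 1) * tildeI (α + 1) z + (z / 2) ^ 2 * tildeI (α + 2) z := by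
  simp only [tildeI_eq_tildeISeries]
  exact tildeISeries_recurrence α _

lemma contDiff_tildeI (α : ℝ) (n : ℕ) : ContDiff ℝ n (tildeI α) := by
  induction n generalizing α with
  | zero =>
    rw [Nat.cast_zero, contDiff_zero]
    exact continuous_iff_continuousAt.2 fun z => (hasDerivAt_tildeI α z).continuousAt
  | succ n ih =>
    rw [Nat.cast_succ, contDiff_succ_iff_deriv]
    refine ⟨fun z => (hasDerivAt_tildeI α z).differentiableAt, by simp, ?_⟩
    rw [show deriv (tildeI α) = fun z => z / 2 * tildeI (α + 1) z from
      funext fun z => (hasDerivAt_tildeI α z).deriv]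
    exact (contDiff_id.div_const 2).mul (ih (α + 1))

lemma hasDerivAt_iteratedDeriv_tildeI (α : ℝ) (n : ℕ) (z : ℝ) :
    HasDerivAt (iteratedDeriv n (tildeI α)) (iteratedDeriv (n + 1) (tildeI α) z) z := by
  rw [iteratedDeriv_succ]
  exact (((contDiff_tildeI α (n + 1)).differentiable_iteratedDeriv n
    (by exact_mod_cast Nat.lt_succ_self n)) z).hasDerivAt

/-- The `n`-th derivative of the Bessel differential equation satisfied by `Ĩ_α`. -/
lemma tildeI_ode (α : ℝ) (n : ℕ) (z : ℝ) :
    z * iteratedDeriv (n + 2) (tildeI α) z + (2 * α + 1 + n) * iteratedDeriv (n + 1) (tildeI α) z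
      = z * iteratedDeriv n (tildeI α) z + n * iteratedDeriv (n - 1) (tildeI α) z := by
  induction n generalizing z with
  | zero =>
    have h1 : iteratedDeriv 1 (tildeI α) = fun w => w / 2 * tildeI (α + 1) w := by
      rw [iteratedDeriv_one]
      exact funext fun w => (hasDerivAt_tildeI α w).deriv
    have h2 : iteratedDeriv 2 (tildeI α) z
        = 1 / 2 * tildeI (α + 1) z + z / 2 * (z / 2 * tildeI (α + 1 + 1) z) := by
      rw [iteratedDeriv_succ, h1]
      exact (((hasDerivAt_id z).div_const 2).mul (hasDerivAt_tildeI (α + 1) z)).deriv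
    simp only [zero_add, h2, h1, iteratedDeriv_zero, Nat.cast_zero]
    rw [tildeI_recurrence α z, show α + 2 = α + 1 + 1 by ring]
    ring
  | succ n ih =>
    have hd := hasDerivAt_iteratedDeriv_tildeI α
    have hL := ((hasDerivAt_id z).mul (hd (n + 2) z)).add
      ((hd (n + 1) z).const_mul (2 * α + 1 + n))
    have hR' : HasDerivAt (fun w => (n : ℝ) * iteratedDeriv (n - 1) (tildeI α) w)
        (n * iteratedDeriv n (tildeI α) z) z := by
      rcases n with _ | m
      · simpa using hasDerivAt_const z (0 : ℝ)
      · exact (hd m z).const_mul _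
    have hR := ((hasDerivAt_id z).mul (hd n z)).add hR'
    have heq := hL.unique (hR.congr_of_eventuallyEq (Eventually.of_forall fun w => ih w))
    simp only [id_eq, one_mul] at heq
    push_cast
    linarith

/-! ### Derivatives at the origin of `e^{εs}·A(s)` -/

/-- If `a i = A⁽ⁱ⁾(0)`, then `twistedCoeff ε a j i` is the `j`-th derivative at `0` of
`e^{εs}·A⁽ⁱ⁾(s)`. -/
def twistedCoeff (ε : ℝ) (a : ℕ → ℝ) : ℕ → ℕ → ℝ
  | 0, i => a i
  | j + 1, i => twistedCoeff ε a j (i + 1) + ε * twistedCoeff ε a j i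

lemma twistedCoeff_relation {ε β : ℝ} {a : ℕ → ℝ}
    (ha : ∀ i : ℕ, (2 * β + 1 + i) * a (i + 1) = i * a (i - 1)) (j k : ℕ) :
    j * twistedCoeff ε a (j - 1) (k + 2) + (2 * β + 1 + k) * twistedCoeff ε a j (k + 1)
      = j * twistedCoeff ε a (j - 1) k + k * twistedCoeff ε a j (k - 1) := by
  induction j generalizing k with
  | zero => simpa [twistedCoeff] using ha k
  | succ j ih =>
    have h1 := ih (k + 1)
    have h0 := ih k
    have e1 : (j : ℝ) * twistedCoeff ε a j (k + 2)
        = j * (twistedCoeff ε a (j - 1) (k + 3) + ε * twistedCoeff ε a (j - 1) (k + 2)) := by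
      rcases j with _ | j
      · simp
      · simp [twistedCoeff]
    have e2 : (j : ℝ) * twistedCoeff ε a j k
        = j * (twistedCoeff ε a (j - 1) (k + 1) + ε * twistedCoeff ε a (j - 1) k) := by
      rcases j with _ | j
      · simp
      · simp [twistedCoeff]
    have e3 : (k : ℝ) * twistedCoeff ε a (j + 1) (k - 1)
        = k * (twistedCoeff ε a j k + ε * twistedCoeff ε a j (k - 1)) := by
      rcases k with _ | k
      · simp
      · simp [twistedCoeff]
    have e4 : twistedCoeff ε a (j + 1) (k + 1)
        = twistedCoeff ε a j (k + 2) + ε * twistedCoeff ε a j (k + 1) := rfl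
    simp only [Nat.add_sub_cancel] at h1 ⊢
    rw [e3, e4]
    push_cast at h1 ⊢
    linear_combination h1 + ε * h0 + e1 - e2

lemma twistedCoeff_succ_eq {ε β : ℝ} (hε : ε ^ 2 = 1) {a : ℕ → ℝ}
    (ha : ∀ i : ℕ, (2 * β + 1 + i) * a (i + 1) = i * a (i - 1)) (j : ℕ) :
    (j + 2 * β + 1) * twistedCoeff ε a (j + 1) 0
      = ε * (2 * j + 2 * β + 1) * twistedCoeff ε a j 0 := by
  have h := twistedCoeff_relation (ε := ε) ha j 0
  have e1 : twistedCoeff ε a (j + 1) 0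
      = twistedCoeff ε a j 1 + ε * twistedCoeff ε a j 0 := rfl
  rcases j with _ | j
  · simp only [zero_add, Nat.cast_zero, zero_mul, add_zero, mul_zero] at h e1 ⊢
    rw [e1]
    linear_combination h
  · have e2 : twistedCoeff ε a (j + 1) 1
        = twistedCoeff ε a j 2 + ε * twistedCoeff ε a j 1 := rfl
    have e3 : twistedCoeff ε a (j + 1) 0
        = twistedCoeff ε a j 1 + ε * twistedCoeff ε a j 0 := rfl
    simp only [Nat.add_sub_cancel, zero_add, Nat.cast_zero, zero_mul, add_zero] at h
    push_cast at h ⊢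
    rw [e1]
    linear_combination h + (j + 1) * e2 - ε * (j + 1) * e3
      - (j + 1) * twistedCoeff ε a j 0 * hε

lemma twistedCoeff_ne_zero {ε β : ℝ} (hε : ε ^ 2 = 1) {a : ℕ → ℝ}
    (ha : ∀ i : ℕ, (2 * β + 1 + i) * a (i + 1) = i * a (i - 1)) (h0 : a 0 ≠ 0)
    (hβ : ∀ n : ℕ, 2 * β ≠ -((n : ℝ) + 1)) (j : ℕ) : twistedCoeff ε a j 0 ≠ 0 := by
  induction j with
  | zero => exact h0
  | succ j ih =>
    intro h
    have hs := twistedCoeff_succ_eq hε ha j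
    rw [h, mul_zero] at hs
    refine mul_ne_zero (mul_ne_zero ?_ ?_) ih hs.symm
    · rintro rfl
      norm_num at hε
    · intro h2
      apply hβ (2 * j)
      push_cast
      linarith

/-! ### Limits at infinity with an `O(1/x)` error -/

/-- `f(x) = c + O(1/x)` as `x → ∞`. -/
def TendsToRate (f : ℝ → ℝ) (c : ℝ) : Prop :=
  (fun x => f x - c) =O[atTop] fun x : ℝ => 1 / x

namespace TendsToRate

variable {f g : ℝ → ℝ} {c d : ℝ}

lemma congr' (hf : TendsToRate f c) (h : ∀ x : ℝ, 1 ≤ x → f x = g x) : TendsToRate g c := by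
  refine Asymptotics.IsBigO.congr' hf ?_ (EventuallyEq.refl _ _)
  filter_upwards [eventually_ge_atTop 1] with x hx
  rw [h x hx]

lemma add (hf : TendsToRate f c) (hg : TendsToRate g d) :
    TendsToRate (fun x => f x + g x) (c + d) :=
  (Asymptotics.IsBigO.add hf hg).congr_left fun x => by ring

lemma const_mul (k : ℝ) (hf : TendsToRate f c) : TendsToRate (fun x => k * f x) (k * c) :=
  (Asymptotics.IsBigO.const_mul_left hf k).congr_left fun x => by ring

lemma of_le {C : ℝ} (h : ∀ x : ℝ, 1 ≤ x → |f x - c| ≤ C / x) : TendsToRate f c := by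
  refine Asymptotics.IsBigO.of_bound C ?_
  filter_upwards [eventually_ge_atTop 1] with x hx
  rw [Real.norm_eq_abs, Real.norm_eq_abs, abs_of_nonneg (by positivity : 0 ≤ 1 / x)]
  exact (h x hx).trans_eq (by ring)

lemma div_id (hf : TendsToRate f c) : TendsToRate (fun x => f x / x) 0 := by
  have h1 : (fun x : ℝ => 1 / x) =O[atTop] fun _ : ℝ => (1 : ℝ) := by
    refine Asymptotics.IsBigO.of_bound 1 ?_
    filter_upwards [eventually_ge_atTop 1] with x hx
    rw [Real.norm_eq_abs, abs_of_nonneg (by positivity : 0 ≤ 1 / x), norm_one, mul_one]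
    exact (div_le_one (by linarith)).2 hx
  have hb : f =O[atTop] fun _ : ℝ => (1 : ℝ) :=
    ((Asymptotics.IsBigO.trans hf h1).add (Asymptotics.isBigO_const_const c one_ne_zero _)).congr_left
      fun x => by ring
  refine (hb.mul (Asymptotics.isBigO_refl (fun x : ℝ => 1 / x) atTop)).congr (fun x => ?_)
    fun x => ?_
  · ring
  · ring

end TendsToRate

/-! ### Taylor coefficients of the generating functions -/

/-- The function `t ↦ (1-t)^c·A(tx/(1-t))·B(x/(1-t))`. -/
def genProd (A B : ℝ → ℝ) (c x t : ℝ) : ℝ :=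
  (1 - t) ^ c * A (t * x / (1 - t)) * B (x / (1 - t))

lemma contDiff_of_deriv_seq {A : ℕ → ℝ → ℝ} (hA : ∀ i w, HasDerivAt (A i) (A (i + 1) w) w)
    (n i : ℕ) : ContDiff ℝ n (A i) := by
  induction n generalizing i with
  | zero =>
    rw [Nat.cast_zero, contDiff_zero]
    exact continuous_iff_continuousAt.2 fun z => (hA i z).continuousAt
  | succ n ih =>
    rw [Nat.cast_succ, contDiff_succ_iff_deriv]
    refine ⟨fun z => (hA i z).differentiableAt, by simp, ?_⟩
    rw [show deriv (A i) = A (i + 1) from funext fun z => (hA i z).deriv]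
    exact ih (i + 1)

lemma contDiffOn_of_deriv_seq {ε : ℝ} {B : ℕ → ℝ → ℝ}
    (hB : ∀ k z, 0 < z → HasDerivAt (B k) (ε * (z / 2) * B (k + 1) z) z)
    (n k : ℕ) : ContDiffOn ℝ n (B k) (Ioi 0) := by
  induction n generalizing k with
  | zero =>
    rw [Nat.cast_zero, contDiffOn_zero]
    exact fun z hz => (hB k z hz).continuousAt.continuousWithinAt
  | succ n ih =>
    rw [Nat.cast_succ, contDiffOn_succ_iff_deriv_of_isOpen isOpen_Ioi]
    refine ⟨fun z hz => (hB k z hz).differentiableAt.differentiableWithinAt, by simp, ?_⟩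
    refine ContDiffOn.congr (f := fun z => ε * (z / 2) * B (k + 1) z) ?_
      fun z hz => (hB k z hz).deriv
    exact (contDiffOn_const.mul (contDiffOn_id.div_const 2)).mul (ih (k + 1))

lemma contDiffAt_genProd {A B : ℝ → ℝ} {n : ℕ} (hA : ContDiff ℝ n A)
    (hB : ContDiffOn ℝ n B (Ioi 0)) (c : ℝ) {x : ℝ} (hx : 0 < x) :
    ContDiffAt ℝ n (genProd A B c x) 0 := by
  have h1 : ContDiffAt ℝ n (fun t : ℝ => 1 - t) 0 := contDiffAt_const.sub contDiffAt_id
  have h10 : (1 : ℝ) - 0 ≠ 0 := by norm_num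
  have h2 : ContDiffAt ℝ n (fun t : ℝ => (1 - t) ^ c) 0 := h1.rpow_const_of_ne h10
  have h3 : ContDiffAt ℝ n (fun t : ℝ => A (t * x / (1 - t))) 0 :=
    hA.contDiffAt.comp (0 : ℝ) ((contDiffAt_id.mul contDiffAt_const).div h1 h10)
  have h4 : ContDiffAt ℝ n (fun t : ℝ => B (x / (1 - t))) 0 := by
    refine ContDiffAt.comp (0 : ℝ) (g := B) ?_ (contDiffAt_const.div h1 h10)
    exact hB.contDiffAt (Ioi_mem_nhds (by simpa using hx))
  exact (h2.mul h3).mul h4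

lemma hasDerivAt_genProd {A A' B B₁ : ℝ → ℝ} {ε c x t : ℝ} (hx : 0 < x) (ht : t < 1)
    (hA : ∀ w, HasDerivAt A (A' w) w)
    (hB : ∀ z, 0 < z → HasDerivAt B (ε * (z / 2) * B₁ z) z) :
    HasDerivAt (genProd A B c x)
      (-c * genProd A B (c - 1) x t + x * genProd A' B (c - 2) x t
        + ε / 2 * x ^ 2 * genProd A B₁ (c - 3) x t) t := by
  have h1t : 0 < 1 - t := by linarith
  have h1 : HasDerivAt (fun s : ℝ => 1 - s) (-1) t := (hasDerivAt_id t).const_sub 1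
  have h2 := h1.rpow_const (p := c) (Or.inl h1t.ne')
  have h3 := (hA (t * x / (1 - t))).comp t
    (((hasDerivAt_id t).mul_const x).div h1 h1t.ne')
  have h4 := (hB (x / (1 - t)) (by positivity)).comp t
    ((hasDerivAt_const t x).div h1 h1t.ne')
  refine ((h2.mul h3).mul h4).congr_deriv ?_
  have r1 : (1 - t) ^ (c - 1) = (1 - t) ^ c / (1 - t) := Real.rpow_sub_one h1t.ne' c
  have r2 : (1 - t) ^ (c - 2) = (1 - t) ^ c / (1 - t) ^ 2 := by
    exact_mod_cast Real.rpow_sub_natCast h1t.ne' c 2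
  have r3 : (1 - t) ^ (c - 3) = (1 - t) ^ c / (1 - t) ^ 3 := by
    exact_mod_cast Real.rpow_sub_natCast h1t.ne' c 3
  simp only [genProd, r1, r2, r3, Function.comp_apply, id_eq, Pi.mul_apply, Pi.div_apply]
  field_simp
  ring

/-- Asymptotic behaviour of the Taylor coefficients at `t = 0` of
`(1-t)^c·A(tx/(1-t))·B(x/(1-t))`, where `A i` is the `i`-th derivative of a smooth function and
`B k` is a family behaving like the modified Bessel functions of shifted order. -/
lemma tendsToRate_iteratedDeriv_genProd {A B : ℕ → ℝ → ℝ} {ε p b : ℝ}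
    (hA : ∀ i w, HasDerivAt (A i) (A (i + 1) w) w)
    (hB : ∀ k z, 0 < z → HasDerivAt (B k) (ε * (z / 2) * B (k + 1) z) z)
    (hasymp : ∀ k : ℕ, TendsToRate
      (fun x => x ^ (p + k) * Real.exp (-(ε * x)) * B k x) (2 ^ k * b))
    (j : ℕ) (c : ℝ) (i k : ℕ) :
    TendsToRate (fun x => x ^ (p + k - j) * Real.exp (-(ε * x)) *
      iteratedDeriv j (genProd (A i) (B k) c x) 0)
      (2 ^ k * b * twistedCoeff ε (fun i => A i 0) j i) := by
  induction j generalizing c i k with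
  | zero =>
    have h := (hasymp k).const_mul (A i 0)
    rw [mul_comm] at h
    refine h.congr' fun x hx => ?_
    simp only [iteratedDeriv_zero, genProd, Nat.cast_zero, sub_zero, Real.one_rpow, div_one,
      zero_mul, one_mul]
    ring
  | succ j ih =>
    have h1 := ((ih (c - 1) i k).div_id).const_mul (-c)
    have h2 := ih (c - 2) (i + 1) k
    have h3 := (ih (c - 3) i (k + 1)).const_mul (ε / 2)
    have h := (h1.add h2).add h3
    have hval : -c * 0 + 2 ^ k * b * twistedCoeff ε (fun i => A i 0) j (i + 1)
        + ε / 2 * (2 ^ (k + 1) * b * twistedCoeff ε (fun i => A i 0) j i)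
        = 2 ^ k * b * twistedCoeff ε (fun i => A i 0) (j + 1) i := by
      simp only [twistedCoeff]
      ring
    rw [hval] at h
    refine h.congr' fun x hx => ?_
    have hx0 : 0 < x := by linarith
    have hder : deriv (genProd (A i) (B k) c x) =ᶠ[𝓝 0] fun t =>
        -c * genProd (A i) (B k) (c - 1) x t + x * genProd (A (i + 1)) (B k) (c - 2) x t
        + ε / 2 * x ^ 2 * genProd (A i) (B (k + 1)) (c - 3) x t := by
      filter_upwards [Iio_mem_nhds (zero_lt_one (α := ℝ))] with t ht
      exact (hasDerivAt_genProd hx0 ht (hA i) (hB k)).deriv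
    have hsm : ∀ i k c, ContDiffAt ℝ j (genProd (A i) (B k) c x) 0 := fun i k c =>
      contDiffAt_genProd (contDiff_of_deriv_seq hA j i) (contDiffOn_of_deriv_seq hB j k) c hx0
    have hit : iteratedDeriv (j + 1) (genProd (A i) (B k) c x) 0 =
        -c * iteratedDeriv j (genProd (A i) (B k) (c - 1) x) 0
        + x * iteratedDeriv j (genProd (A (i + 1)) (B k) (c - 2) x) 0
        + ε / 2 * x ^ 2 * iteratedDeriv j (genProd (A i) (B (k + 1)) (c - 3) x) 0 := by
      rw [iteratedDeriv_succ', hder.iteratedDeriv_eq,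
        iteratedDeriv_fun_add ((contDiffAt_const.mul (hsm _ _ _)).add
          (contDiffAt_const.mul (hsm _ _ _))) (contDiffAt_const.mul (hsm _ _ _)),
        iteratedDeriv_fun_add (contDiffAt_const.mul (hsm _ _ _))
          (contDiffAt_const.mul (hsm _ _ _)),
        iteratedDeriv_const_mul_field, iteratedDeriv_const_mul_field,
        iteratedDeriv_const_mul_field]
    rw [hit]
    have e1 : x ^ (p + k - j) = x ^ (p + k - (j + 1 : ℕ)) * x := by
      rw [← Real.rpow_add_one hx0.ne']
      push_cast
      ring_nf
    have e2 : x ^ (p + (k + 1 : ℕ) - j) = x ^ (p + k - (j + 1 : ℕ)) * x ^ 2 := by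
      rw [← Real.rpow_add_natCast hx0.ne']
      push_cast
      ring_nf
    rw [e1, e2]
    field_simp

/-! ### Asymptotic behaviour of the I-Bessel functions -/

lemma continuous_one_sub_sq_rpow {a : ℝ} (ha : 0 ≤ a) :
    Continuous fun u : ℝ => (1 - u ^ 2) ^ a :=
  (continuous_const.sub (continuous_pow 2)).rpow_const fun _ => Or.inr ha

/-- The even moments of the weight `(1-u²)^a` on `[-1,1]`. -/
def evenMoment (a : ℝ) (n : ℕ) : ℝ := ∫ u in (-1 : ℝ)..1, (1 - u ^ 2) ^ a * u ^ (2 * n)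

lemma one_sub_sq_nonneg {u : ℝ} (hu : u ∈ uIcc (-1 : ℝ) 1) : 0 ≤ 1 - u ^ 2 := by
  rw [uIcc_of_le (by norm_num), mem_Icc] at hu
  nlinarith [hu.1, hu.2]

lemma evenMoment_add_one {a : ℝ} (ha : 0 ≤ a) (n : ℕ) :
    evenMoment (a + 1) n = evenMoment a n - evenMoment a (n + 1) := by
  have hc := continuous_one_sub_sq_rpow ha
  unfold evenMoment
  rw [← intervalIntegral.integral_sub (by apply Continuous.intervalIntegrable; fun_prop)
    (by apply Continuous.intervalIntegrable; fun_prop)]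
  refine intervalIntegral.integral_congr fun u hu => ?_
  rw [Real.rpow_add_one' (one_sub_sq_nonneg hu) (by positivity)]
  ring

lemma evenMoment_succ {a : ℝ} (ha : 0 ≤ a) (n : ℕ) :
    (2 * n + 2 * a + 3) * evenMoment a (n + 1) = (2 * n + 1) * evenMoment a n := by
  have hc := continuous_one_sub_sq_rpow ha
  have hc' := continuous_one_sub_sq_rpow (by linarith : 0 ≤ a + 1)
  have hd : ∀ u : ℝ, HasDerivAt (fun u : ℝ => (1 - u ^ 2) ^ (a + 1) * u ^ (2 * n + 1))
      ((2 * n + 1) * ((1 - u ^ 2) ^ (a + 1) * u ^ (2 * n))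
        - 2 * (a + 1) * ((1 - u ^ 2) ^ a * u ^ (2 * (n + 1)))) u := by
    intro u
    have h1 : HasDerivAt (fun u : ℝ => 1 - u ^ 2) (-(2 * u)) u := by
      simpa using (hasDerivAt_pow 2 u).const_sub 1
    have h2 := (h1.rpow_const (p := a + 1) (Or.inr (by linarith))).mul
      (hasDerivAt_pow (2 * n + 1) u)
    refine h2.congr_deriv ?_
    rw [add_sub_cancel_right]
    push_cast
    ring
  have hint := intervalIntegral.integral_eq_sub_of_hasDerivAt (a := -1) (b := 1)
    (fun u _ => hd u) (by apply Continuous.intervalIntegrable; fun_prop)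
  rw [intervalIntegral.integral_sub (by apply Continuous.intervalIntegrable; fun_prop)
    (by apply Continuous.intervalIntegrable; fun_prop),
    intervalIntegral.integral_const_mul, intervalIntegral.integral_const_mul] at hint
  have hz : (0 : ℝ) ^ (a + 1) = 0 := Real.zero_rpow (by positivity)
  norm_num [hz] at hint
  have h3 := evenMoment_add_one ha n
  unfold evenMoment at h3 ⊢
  rw [h3] at hint
  linarith

lemma evenMoment_zero_pos {a : ℝ} (ha : 0 ≤ a) : 0 < evenMoment a 0 := by
  unfold evenMoment
  refine intervalIntegral.intervalIntegral_pos_of_pos_on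
    (((continuous_one_sub_sq_rpow ha).mul (continuous_pow _)).intervalIntegrable _ _)
    (fun u hu => ?_) (by norm_num)
  have : 0 < 1 - u ^ 2 := by nlinarith [hu.1, hu.2]
  simpa using Real.rpow_pos_of_pos this a

lemma evenMoment_eq {a : ℝ} (ha : 0 ≤ a) (n : ℕ) :
    evenMoment a n = (2 * n).factorial / 4 ^ n *
      (evenMoment a 0 * Real.Gamma (a + 3 / 2) * tildeICoeff (a + 1 / 2) n) := by
  induction n with
  | zero =>
    have : Real.Gamma (a + 3 / 2) ≠ 0 := (Real.Gamma_pos_of_pos (by linarith)).ne'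
    simp only [tildeICoeff, mul_zero, Nat.factorial_zero, Nat.cast_one, pow_zero, div_one,
      Nat.cast_zero, zero_add, one_mul]
    rw [show a + 1 / 2 + 1 = a + 3 / 2 by ring]
    field_simp
  | succ n ih =>
    have h1 := evenMoment_succ ha n
    have h2 := succ_mul_tildeICoeff_succ (a + 1 / 2) n
    have h3 := tildeICoeff_eq (a + 1 / 2) n
    rw [ih, h3, ← h2] at h1
    have h4 : (2 * (n : ℝ) + 2 * a + 3) ≠ 0 := by positivity
    have h5 : ((2 * (n + 1)).factorial : ℝ)
        = (2 * n + 2) * ((2 * n + 1) * (2 * n).factorial) := by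
      rw [show 2 * (n + 1) = 2 * n + 1 + 1 by ring, Nat.factorial_succ, Nat.factorial_succ]
      push_cast
      ring
    apply mul_left_cancel₀ h4
    rw [h1, h5]
    field_simp
    ring

/-- The Poisson integral representation of `Ĩ_{a+1/2}`. -/
lemma integral_mul_cosh_eq_tildeI {a : ℝ} (ha : 0 ≤ a) (z : ℝ) :
    ∫ u in (-1 : ℝ)..1, (1 - u ^ 2) ^ a * Real.cosh (z * u)
      = evenMoment a 0 * Real.Gamma (a + 3 / 2) * tildeI (a + 1 / 2) z := by
  have hc := continuous_one_sub_sq_rpow ha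
  have hsum : HasSum (fun n : ℕ => ∫ u in (-1 : ℝ)..1,
      (1 - u ^ 2) ^ a * ((z * u) ^ (2 * n) / (2 * n).factorial))
      (∫ u in (-1 : ℝ)..1, (1 - u ^ 2) ^ a * Real.cosh (z * u)) := by
    refine intervalIntegral.hasSum_integral_of_dominated_convergence
      (fun n _ => z ^ (2 * n) / (2 * n).factorial) (fun n => ?_) (fun n => ?_) ?_ ?_ ?_
    · exact (by fun_prop : Continuous fun u : ℝ =>
        (1 - u ^ 2) ^ a * ((z * u) ^ (2 * n) / (2 * n).factorial)).aestronglyMeasurable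
    · refine Eventually.of_forall fun u hu => ?_
      have hu' := uIoc_subset_uIcc hu
      have h1 := one_sub_sq_nonneg hu'
      have h2 : (1 - u ^ 2) ^ a ≤ 1 := Real.rpow_le_one h1 (by nlinarith [sq_nonneg u]) ha
      have h3 : (u ^ 2) ^ n ≤ 1 := pow_le_one₀ (sq_nonneg u) (by linarith)
      rw [mul_pow, pow_mul z, pow_mul u, Real.norm_eq_abs, abs_of_nonneg (by positivity)]
      calc (1 - u ^ 2) ^ a * ((z ^ 2) ^ n * (u ^ 2) ^ n / (2 * n).factorial)
          ≤ 1 * ((z ^ 2) ^ n * 1 / (2 * n).factorial) := by gcongr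
        _ = (z ^ 2) ^ n / (2 * n).factorial := by ring
    · exact Eventually.of_forall fun _ _ => (Real.hasSum_cosh z).summable
    · exact intervalIntegrable_const
    · exact Eventually.of_forall fun u _ => (Real.hasSum_cosh (z * u)).mul_left _
  have hsum' : HasSum (fun n : ℕ => evenMoment a 0 * Real.Gamma (a + 3 / 2) *
      (((z / 2) ^ 2) ^ n * tildeICoeff (a + 1 / 2) n))
      (evenMoment a 0 * Real.Gamma (a + 3 / 2) * tildeI (a + 1 / 2) z) := by
    rw [tildeI_eq_tildeISeries]
    exact (summable_tildeICoeff _ _).hasSum.mul_left _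
  refine hsum.unique (hsum'.congr_fun fun n => ?_)
  have h1 : ∀ u : ℝ, (1 - u ^ 2) ^ a * ((z * u) ^ (2 * n) / (2 * n).factorial)
      = z ^ (2 * n) / (2 * n).factorial * ((1 - u ^ 2) ^ a * u ^ (2 * n)) := fun u => by ring
  simp only [h1]
  rw [intervalIntegral.integral_const_mul]
  change _ * evenMoment a n = _
  rw [evenMoment_eq ha n, div_pow, div_pow, ← pow_mul, show (2 : ℝ) ^ 2 = 4 by norm_num]
  have : ((2 * n).factorial : ℝ) ≠ 0 := by positivity
  field_simp

lemma exp_neg_mul_integral_cosh {a : ℝ} (ha : 0 ≤ a) (z : ℝ) :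
    Real.exp (-z) * ∫ u in (-1 : ℝ)..1, (1 - u ^ 2) ^ a * Real.cosh (z * u)
      = ∫ s in Ioc (0 : ℝ) 2, s ^ a * (2 - s) ^ a * Real.exp (-(z * s)) := by
  have hc := continuous_one_sub_sq_rpow ha
  have h1 : ∫ u in (-1 : ℝ)..1, (1 - u ^ 2) ^ a * Real.exp (-(z * u))
      = ∫ u in (-1 : ℝ)..1, (1 - u ^ 2) ^ a * Real.exp (z * u) := by
    have := intervalIntegral.integral_comp_neg (a := -1) (b := 1)
      fun u : ℝ => (1 - u ^ 2) ^ a * Real.exp (z * u)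
    simpa using this
  have h2 : ∫ u in (-1 : ℝ)..1, (1 - u ^ 2) ^ a * Real.cosh (z * u)
      = ∫ u in (-1 : ℝ)..1, (1 - u ^ 2) ^ a * Real.exp (z * u) := by
    have h3 : ∀ u : ℝ, (1 - u ^ 2) ^ a * Real.cosh (z * u)
        = 1 / 2 * ((1 - u ^ 2) ^ a * Real.exp (z * u))
          + 1 / 2 * ((1 - u ^ 2) ^ a * Real.exp (-(z * u))) := fun u => by
      rw [Real.cosh_eq]
      ring
    simp only [h3]
    rw [intervalIntegral.integral_add (by apply Continuous.intervalIntegrable; fun_prop)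
      (by apply Continuous.intervalIntegrable; fun_prop), intervalIntegral.integral_const_mul,
      intervalIntegral.integral_const_mul, h1]
    ring
  rw [h2, ← intervalIntegral.integral_const_mul]
  have h4 := intervalIntegral.integral_comp_sub_left (a := 0) (b := 2)
    (fun u : ℝ => Real.exp (-z) * ((1 - u ^ 2) ^ a * Real.exp (z * u))) 1
  rw [show (1 : ℝ) - 2 = -1 by norm_num, sub_zero] at h4
  rw [← h4, ← intervalIntegral.integral_of_le (by norm_num)]
  refine intervalIntegral.integral_congr fun s hs => ?_
  rw [uIcc_of_le (by norm_num), mem_Icc] at hs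
  rw [← Real.mul_rpow hs.1 (by linarith [hs.2]), mul_left_comm, ← Real.exp_add]
  ring_nf

lemma integrableOn_rpow_mul_exp_neg {a z : ℝ} (ha : -1 < a) (hz : 0 < z) :
    IntegrableOn (fun s : ℝ => s ^ a * Real.exp (-(z * s))) (Ioi 0) := by
  simpa [neg_mul] using integrableOn_rpow_mul_exp_neg_mul_rpow ha one_pos hz

lemma abs_two_sub_rpow_sub_le {a s : ℝ} (ha : 1 ≤ a) (hs : 0 ≤ s) (hs2 : s ≤ 2) :
    |(2 - s) ^ a - 2 ^ a| ≤ 2 ^ a * a * s := by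
  have h1 : (2 - s) ^ a = 2 ^ a * (1 + -(s / 2)) ^ a := by
    rw [← Real.mul_rpow (by norm_num) (by linarith)]
    ring_nf
  have h2 := one_add_mul_self_le_rpow_one_add (by linarith : -1 ≤ -(s / 2)) ha
  have h3 : (1 + -(s / 2)) ^ a ≤ 1 := Real.rpow_le_one (by linarith) (by linarith) (by linarith)
  have h4 : (0 : ℝ) < 2 ^ a := by positivity
  have h5 : 0 ≤ a * s := by positivity
  rw [h1, abs_le]
  constructor <;> nlinarith

lemma abs_integral_Ioc_sub_le {a z : ℝ} (ha : 1 ≤ a) (hz : 0 < z) :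
    |(∫ s in Ioc (0 : ℝ) 2, s ^ a * (2 - s) ^ a * Real.exp (-(z * s)))
      - 2 ^ a * ((1 / z) ^ (a + 1) * Real.Gamma (a + 1))|
      ≤ 2 ^ a * a * ((1 / z) ^ (a + 2) * Real.Gamma (a + 2)) := by
  have hG : ∀ b : ℝ, 0 ≤ b → ∫ s in Ioi (0 : ℝ), s ^ b * Real.exp (-(z * s))
      = (1 / z) ^ (b + 1) * Real.Gamma (b + 1) := fun b hb => by
    rw [← Real.integral_rpow_mul_exp_neg_mul_Ioi (by linarith) hz, add_sub_cancel_right]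
  have hcont : Continuous fun s : ℝ => s ^ a * (2 - s) ^ a * Real.exp (-(z * s)) :=
    ((continuous_id.rpow_const fun _ => Or.inr (by linarith)).mul
      ((continuous_const.sub continuous_id).rpow_const fun _ => Or.inr (by linarith))).mul
      (by fun_prop)
  have hint : IntegrableOn (fun s : ℝ => s ^ a * (2 - s) ^ a * Real.exp (-(z * s))) (Ioc 0 2) :=
    (hcont.integrableOn_Icc).mono_set Ioc_subset_Icc_self
  have hsub : Ioc (0 : ℝ) 2 ⊆ Ioi 0 := Ioc_subset_Ioi_self
  have hind : IntegrableOn ((Ioc (0 : ℝ) 2).indicator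
      fun s : ℝ => s ^ a * (2 - s) ^ a * Real.exp (-(z * s))) (Ioi 0) :=
    (hint.integrable_indicator measurableSet_Ioc).integrableOn
  rw [← hG a (by linarith), ← integral_const_mul,
    ← inter_eq_self_of_subset_right hsub, ← setIntegral_indicator measurableSet_Ioc,
    ← integral_sub hind ((integrableOn_rpow_mul_exp_neg (by linarith) hz).const_mul _),
    show a + 2 = a + 1 + 1 by ring, ← hG (a + 1) (by linarith), ← integral_const_mul]
  rw [← Real.norm_eq_abs]
  refine norm_integral_le_of_norm_le
    ((integrableOn_rpow_mul_exp_neg (by linarith) hz).const_mul _) ?_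
  refine (ae_restrict_iff' measurableSet_Ioi).2 (Eventually.of_forall fun s hs => ?_)
  have hs0 : 0 < s := hs
  have hE : 0 ≤ s ^ a * Real.exp (-(z * s)) := by positivity
  rw [Real.norm_eq_abs, Real.rpow_add_one hs0.ne']
  by_cases h2 : s ≤ 2
  · rw [indicator_of_mem (show s ∈ Ioc (0 : ℝ) 2 from ⟨hs0, h2⟩),
      show s ^ a * (2 - s) ^ a * Real.exp (-(z * s)) - 2 ^ a * (s ^ a * Real.exp (-(z * s)))
        = ((2 - s) ^ a - 2 ^ a) * (s ^ a * Real.exp (-(z * s))) by ring, abs_mul,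
      abs_of_nonneg hE]
    calc _ ≤ 2 ^ a * a * s * (s ^ a * Real.exp (-(z * s))) :=
          mul_le_mul_of_nonneg_right (abs_two_sub_rpow_sub_le ha hs0.le h2) hE
      _ = _ := by ring
  · rw [indicator_of_notMem (fun h : s ∈ Ioc (0 : ℝ) 2 => h2 h.2), zero_sub, abs_neg,
      abs_of_nonneg (by positivity)]
    push Not at h2
    calc 2 ^ a * (s ^ a * Real.exp (-(z * s)))
        ≤ (a * s) * (2 ^ a * (s ^ a * Real.exp (-(z * s)))) :=
          le_mul_of_one_le_left (by positivity) (by nlinarith)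
      _ = _ := by ring

/-- The constant `b` with `Ĩ_{a+1/2}(x) ~ b·x^{-a-1}·eˣ`. -/
def tildeIConst (a : ℝ) : ℝ :=
  2 ^ a * Real.Gamma (a + 1) / (evenMoment a 0 * Real.Gamma (a + 3 / 2))

lemma tildeIConst_pos {a : ℝ} (ha : 0 ≤ a) : 0 < tildeIConst a := by
  have h1 := evenMoment_zero_pos ha
  have h2 := Real.Gamma_pos_of_pos (by linarith : 0 < a + 3 / 2)
  have h3 := Real.Gamma_pos_of_pos (by linarith : 0 < a + 1)
  unfold tildeIConst
  positivity

lemma tildeIConst_add_one {a : ℝ} (ha : 0 ≤ a) : tildeIConst (a + 1) = 2 * tildeIConst a := by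
  have h1 := evenMoment_zero_pos ha
  have h2 := Real.Gamma_pos_of_pos (by linarith : 0 < a + 3 / 2)
  have h3 := evenMoment_succ ha 0
  have h4 := evenMoment_add_one ha 0
  have h5 : evenMoment (a + 1) 0 = (a + 1) / (a + 3 / 2) * evenMoment a 0 := by
    rw [h4]
    have : a + 3 / 2 ≠ 0 := by positivity
    field_simp
    simp only [Nat.cast_zero] at h3
    linear_combination -h3
  unfold tildeIConst
  rw [h5, Real.rpow_add_one two_ne_zero, Real.Gamma_add_one (by positivity : a + 1 ≠ 0),
    show a + 1 + 3 / 2 = a + 3 / 2 + 1 by ring,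
    Real.Gamma_add_one (by positivity : a + 3 / 2 ≠ 0)]
  have h6 : a + 1 ≠ 0 := by positivity
  have h7 : a + 3 / 2 ≠ 0 := by positivity
  field_simp

lemma tendsToRate_tildeI_of_one_le {a : ℝ} (ha : 1 ≤ a) :
    TendsToRate (fun x => x ^ (a + 1) * Real.exp (-x) * tildeI (a + 1 / 2) x)
      (tildeIConst a) := by
  have h1 := evenMoment_zero_pos (by linarith : 0 ≤ a)
  have h2 := Real.Gamma_pos_of_pos (by linarith : 0 < a + 3 / 2)
  have key : TendsToRate (fun x => x ^ (a + 1) *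
      ∫ s in Ioc (0 : ℝ) 2, s ^ a * (2 - s) ^ a * Real.exp (-(x * s)))
      (2 ^ a * Real.Gamma (a + 1)) := by
    refine TendsToRate.of_le (C := 2 ^ a * a * Real.Gamma (a + 2)) fun x hx => ?_
    have hx0 : 0 < x := by linarith
    have hxa : (1 / x) ^ (a + 1) = (x ^ (a + 1))⁻¹ := by
      rw [one_div, Real.inv_rpow hx0.le]
    have hxa' : (1 / x) ^ (a + 2) = (x ^ (a + 1))⁻¹ * x⁻¹ := by
      rw [show a + 2 = a + 1 + 1 by ring, Real.rpow_add_one (by positivity), hxa, one_div]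
    have hp : 0 < x ^ (a + 1) := by positivity
    have h := mul_le_mul_of_nonneg_left (abs_integral_Ioc_sub_le ha hx0) hp.le
    rw [hxa, hxa'] at h
    nth_rewrite 1 [← abs_of_pos hp] at h
    rw [← abs_mul] at h
    refine (le_of_eq ?_).trans (h.trans_eq ?_)
    · congr 1
      generalize ∫ s in Ioc (0 : ℝ) 2, s ^ a * (2 - s) ^ a * Real.exp (-(x * s)) = J
      field_simp
    · field_simp
  have h := key.const_mul (evenMoment a 0 * Real.Gamma (a + 3 / 2))⁻¹
  rw [show (evenMoment a 0 * Real.Gamma (a + 3 / 2))⁻¹ * (2 ^ a * Real.Gamma (a + 1))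
    = tildeIConst a by unfold tildeIConst; ring] at h
  refine h.congr' fun x _ => ?_
  rw [← exp_neg_mul_integral_cosh (by linarith), integral_mul_cosh_eq_tildeI (by linarith)]
  field_simp

lemma exists_tendsToRate_tildeI (α : ℝ) : ∃ b : ℝ, b ≠ 0 ∧ ∀ k : ℕ,
    TendsToRate (fun x => x ^ (α + 1 / 2 + k) * Real.exp (-x) * tildeI (α + k) x)
      (2 ^ k * b) := by
  obtain ⟨N, hN⟩ := exists_nat_ge (3 / 2 - α)
  induction N generalizing α with
  | zero =>
    rw [Nat.cast_zero] at hN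
    have ha : 1 ≤ α - 1 / 2 := by linarith
    refine ⟨tildeIConst (α - 1 / 2), (tildeIConst_pos (by linarith)).ne', fun k => ?_⟩
    have hk : tildeIConst (α - 1 / 2 + k) = 2 ^ k * tildeIConst (α - 1 / 2) := by
      induction k with
      | zero => simp
      | succ k ih =>
        push_cast
        rw [← add_assoc, tildeIConst_add_one (by positivity), ih]
        ring
    have h := tendsToRate_tildeI_of_one_le
      (by linarith [Nat.cast_nonneg (α := ℝ) k] : 1 ≤ α - 1 / 2 + k)
    rw [hk, show α - 1 / 2 + k + 1 = α + 1 / 2 + k by ring,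
      show α - 1 / 2 + k + 1 / 2 = α + k by ring] at h
    exact h
  | succ N ih =>
    push_cast at hN
    obtain ⟨b, hb, h⟩ := ih (α + 1) (by linarith)
    refine ⟨b / 2, by positivity, fun k => ?_⟩
    rcases k with _ | k
    · have h0 := (h 0).div_id.const_mul (α + 1)
      have h1 := (h 1).const_mul (1 / 4)
      have h2 := h0.add h1
      rw [show (α + 1) * 0 + 1 / 4 * (2 ^ 1 * b) = 2 ^ 0 * (b / 2) by ring] at h2
      refine h2.congr' fun x hx => ?_
      have hx0 : 0 < x := by linarith
      simp only [Nat.cast_zero, Nat.cast_one, add_zero]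
      rw [tildeI_recurrence α x, show α + 1 + 1 = α + 2 by ring,
        show α + 1 + 1 / 2 + 1 = α + 1 / 2 + 1 + 1 by ring,
        show α + 1 + 1 / 2 = α + 1 / 2 + 1 by ring,
        Real.rpow_add_one hx0.ne' (α + 1 / 2 + 1), Real.rpow_add_one hx0.ne' (α + 1 / 2)]
      field_simp
      ring
    · have hk := h k
      rw [show 2 ^ k * b = 2 ^ (k + 1) * (b / 2) by ring] at hk
      refine hk.congr' fun x _ => ?_
      push_cast
      rw [show α + 1 + 1 / 2 + (k : ℝ) = α + 1 / 2 + (k + 1) by ring,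
        show α + 1 + (k : ℝ) = α + (k + 1) by ring]

/-! ### Differentiation and asymptotic behaviour of the K-Bessel functions -/

lemma cosh_sub_one_eq (s : ℝ) : Real.cosh s - 1 = 2 * Real.sinh (s / 2) ^ 2 := by
  have h := Real.cosh_two_mul (s / 2)
  rw [Real.cosh_sq, mul_div_cancel₀ _ two_ne_zero] at h
  linarith

lemma one_add_sq_div_two_le_cosh (s : ℝ) : 1 + s ^ 2 / 2 ≤ Real.cosh s := by
  have h1 : (s / 2) ^ 2 ≤ Real.sinh (s / 2) ^ 2 := by
    rw [sq_le_sq, Real.abs_sinh]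
    exact Real.self_le_sinh_iff.2 (abs_nonneg _)
  have h2 := cosh_sub_one_eq s
  nlinarith

lemma abs_sinh_le (x : ℝ) : |Real.sinh x| ≤ |x| * Real.exp |x| := by
  rw [Real.abs_sinh, Real.sinh_eq]
  have h1 := Real.add_one_le_exp (-(2 * |x|))
  have h2 : Real.exp (-|x|) = Real.exp (-(2 * |x|)) * Real.exp |x| := by
    rw [← Real.exp_add]
    ring_nf
  rw [h2]
  nlinarith [Real.exp_pos |x|]

lemma abs_cosh_sub_one_le (x : ℝ) : |Real.cosh x - 1| ≤ x ^ 2 / 2 * Real.exp |x| := by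
  have h1 := pow_le_pow_left₀ (abs_nonneg _) (abs_sinh_le (x / 2)) 2
  rw [sq_abs, mul_pow, sq_abs, ← Real.exp_nat_mul, abs_div, abs_two] at h1
  rw [cosh_sub_one_eq, abs_of_nonneg (by positivity)]
  calc 2 * Real.sinh (x / 2) ^ 2
      ≤ 2 * ((x / 2) ^ 2 * Real.exp ((2 : ℕ) * (|x| / 2))) := by gcongr
    _ = x ^ 2 / 2 * Real.exp |x| := by
      push_cast
      rw [mul_div_cancel₀ _ two_ne_zero]
      ring

lemma cosh_le_exp_abs (x : ℝ) : Real.cosh x ≤ Real.exp |x| := by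
  rw [← Real.cosh_abs, ← Real.cosh_add_sinh]
  linarith [Real.sinh_nonneg_iff.2 (abs_nonneg x)]

lemma abs_sinh_le_exp_abs (x : ℝ) : |Real.sinh x| ≤ Real.exp |x| := by
  rw [Real.abs_sinh, ← Real.cosh_add_sinh]
  linarith [Real.cosh_pos |x|]

lemma exp_neg_mul_cosh_mul_exp_le {z : ℝ} (hz : 0 < z) (M s : ℝ) :
    Real.exp (-z * Real.cosh s) * Real.exp (M * |s|)
      ≤ Real.exp (M ^ 2 / z) * Real.exp (-(z / 4) * s ^ 2) := by
  rw [← Real.exp_add, ← Real.exp_add, Real.exp_le_exp]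
  have h1 := mul_le_mul_of_nonneg_left (one_add_sq_div_two_le_cosh s) hz.le
  have h2 : M ^ 2 / z + z / 4 * s ^ 2 - M * |s| = (M - z / 2 * |s|) ^ 2 / z := by
    rw [← sq_abs s]
    field_simp
    ring
  have h3 : 0 ≤ (M - z / 2 * |s|) ^ 2 / z := by positivity
  nlinarith

lemma integrableOn_exp_neg_mul_cosh_mul {z : ℝ} (hz : 0 < z) {g : ℝ → ℝ} (hg : Continuous g)
    {M : ℝ} (h : ∀ s, |g s| ≤ Real.exp (M * |s|)) :
    IntegrableOn (fun s => Real.exp (-z * Real.cosh s) * g s) (Ioi 0) := by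
  have hz4 : 0 < z / 4 := by positivity
  refine (((integrable_exp_neg_mul_sq hz4).const_mul (Real.exp (M ^ 2 / z))).mono'
    (by fun_prop : Continuous _).aestronglyMeasurable
    (Eventually.of_forall fun s => ?_)).integrableOn
  rw [Real.norm_eq_abs, abs_mul, abs_of_pos (Real.exp_pos _)]
  exact (mul_le_mul_of_nonneg_left (h s) (Real.exp_pos _).le).trans
    (exp_neg_mul_cosh_mul_exp_le hz M s)

lemma abs_cosh_mul_le (α s : ℝ) : |Real.cosh (α * s)| ≤ Real.exp (|α| * |s|) := by
  rw [abs_of_pos (Real.cosh_pos _), ← abs_mul]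
  exact cosh_le_exp_abs _

lemma abs_sinh_mul_le (α s : ℝ) : |Real.sinh (α * s)| ≤ Real.exp (|α| * |s|) := by
  rw [← abs_mul]
  exact abs_sinh_le_exp_abs _

lemma abs_cosh_mul_cosh_le (α s : ℝ) :
    |Real.cosh s * Real.cosh (α * s)| ≤ Real.exp ((1 + |α|) * |s|) := by
  rw [abs_mul, add_mul, one_mul, Real.exp_add, abs_of_pos (Real.cosh_pos s)]
  exact mul_le_mul (cosh_le_exp_abs s) (abs_cosh_mul_le α s) (abs_nonneg _) (Real.exp_pos _).le

lemma abs_sinh_mul_sinh_le (α s : ℝ) :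
    |Real.sinh s * Real.sinh (α * s)| ≤ Real.exp ((1 + |α|) * |s|) := by
  rw [abs_mul, add_mul, one_mul, Real.exp_add]
  exact mul_le_mul (abs_sinh_le_exp_abs s) (abs_sinh_mul_le α s) (abs_nonneg _)
    (Real.exp_pos _).le

lemma hasDerivAt_besselK_integral (α : ℝ) {z : ℝ} (hz : 0 < z) :
    HasDerivAt (besselK α)
      (∫ s in Ioi (0 : ℝ),
        -(Real.exp (-z * Real.cosh s) * (Real.cosh s * Real.cosh (α * s)))) z := by
  have hz2 : 0 < z / 2 := by positivity
  refine (hasDerivAt_integral_of_dominated_loc_of_deriv_le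
    (bound := fun s => Real.exp (-(z / 2) * Real.cosh s) * (Real.cosh s * Real.cosh (α * s)))
    (F := fun w s => Real.exp (-w * Real.cosh s) * Real.cosh (α * s))
    (F' := fun w s => -(Real.exp (-w * Real.cosh s) * (Real.cosh s * Real.cosh (α * s))))
    (Ioi_mem_nhds (by linarith : z / 2 < z)) (Eventually.of_forall fun w => ?_)
    (integrableOn_exp_neg_mul_cosh_mul hz (by fun_prop) (abs_cosh_mul_le α)) ?_ ?_
    (integrableOn_exp_neg_mul_cosh_mul hz2 (by fun_prop) (abs_cosh_mul_cosh_le α)) ?_).2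
  · exact (by fun_prop : Continuous _).aestronglyMeasurable
  · exact (by fun_prop : Continuous _).aestronglyMeasurable
  · refine Eventually.of_forall fun s w hw => ?_
    have hw' : z / 2 < w := hw
    have h1 := Real.cosh_pos s
    have h2 := Real.cosh_pos (α * s)
    rw [norm_neg, Real.norm_eq_abs, abs_of_pos (by positivity)]
    gcongr
  · refine Eventually.of_forall fun s w _ => ?_
    have h := (((hasDerivAt_id w).neg.mul_const (Real.cosh s)).exp).mul_const (Real.cosh (α * s))
    refine h.congr_deriv ?_
    simp only [id, Pi.neg_apply]
    ring

lemma mul_integral_sinh_mul_sinh (α : ℝ) {z : ℝ} (hz : 0 < z) :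
    z * ∫ s in Ioi (0 : ℝ), Real.exp (-z * Real.cosh s) * (Real.sinh s * Real.sinh (α * s))
      = α * besselK α z := by
  have hI := integrableOn_exp_neg_mul_cosh_mul hz (by fun_prop) (abs_sinh_mul_sinh_le α)
  have hK := integrableOn_exp_neg_mul_cosh_mul hz (by fun_prop) (abs_cosh_mul_le α)
  have hS := integrableOn_exp_neg_mul_cosh_mul hz (by fun_prop) (abs_sinh_mul_le α)
  have hd : ∀ s : ℝ, HasDerivAt (fun s => Real.exp (-z * Real.cosh s) * Real.sinh (α * s))
      (α * (Real.exp (-z * Real.cosh s) * Real.cosh (α * s))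
        - z * (Real.exp (-z * Real.cosh s) * (Real.sinh s * Real.sinh (α * s)))) s := by
    intro s
    have h := (((Real.hasDerivAt_cosh s).const_mul (-z)).exp).mul
      (((hasDerivAt_id s).const_mul α).sinh)
    refine h.congr_deriv ?_
    simp only [id]
    ring
  have hint := (hK.const_mul α).sub (hI.const_mul z)
  have h := integral_Ioi_of_hasDerivAt_of_tendsto (hd 0).continuousAt.continuousWithinAt
    (fun s _ => hd s) hint
    (tendsto_zero_of_hasDerivAt_of_integrableOn_Ioi (fun s _ => hd s) hint hS)
  rw [integral_sub (hK.const_mul α) (hI.const_mul z), integral_const_mul, integral_const_mul] at h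
  simp only [mul_zero, Real.sinh_zero, sub_zero] at h
  unfold besselK
  linarith

lemma hasDerivAt_besselK (α : ℝ) {z : ℝ} (hz : 0 < z) :
    HasDerivAt (besselK α) (-besselK (α + 1) z + α / z * besselK α z) z := by
  refine (hasDerivAt_besselK_integral α hz).congr_deriv ?_
  have hI := integrableOn_exp_neg_mul_cosh_mul hz (by fun_prop) (abs_sinh_mul_sinh_le α)
  have hK := integrableOn_exp_neg_mul_cosh_mul hz (by fun_prop) (abs_cosh_mul_le (α + 1))
  rw [div_mul_eq_mul_div, ← mul_integral_sinh_mul_sinh α hz, mul_div_cancel_left₀ _ hz.ne']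
  unfold besselK
  rw [neg_add_eq_sub, ← integral_sub hI hK]
  refine integral_congr_ae (Eventually.of_forall fun s => ?_)
  beta_reduce
  rw [add_mul, one_mul, Real.cosh_add]
  ring

lemma hasDerivAt_tildeK (α : ℝ) {z : ℝ} (hz : 0 < z) :
    HasDerivAt (tildeK α) (-1 * (z / 2) * tildeK (α + 1) z) z := by
  have hz2 : z / 2 ≠ 0 := by positivity
  have h := (((hasDerivAt_id z).div_const 2).rpow_const (p := -α) (Or.inl hz2)).mul
    (hasDerivAt_besselK α hz)
  refine h.congr_deriv ?_
  simp only [id, tildeK]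
  rw [Real.rpow_sub_one hz2, neg_add, ← sub_eq_add_neg, Real.rpow_sub_one hz2]
  field_simp
  ring

lemma besselK_one_half {z : ℝ} (hz : 0 < z) :
    besselK (1 / 2) z = Real.exp (-z) * √(Real.pi / (2 * z)) := by
  have hz2 : 0 < 2 * z := by positivity
  have hE : ∀ s : ℝ, Real.exp (-z * Real.cosh s) * Real.cosh (1 / 2 * s)
      = 2 * Real.exp (-z) *
        (Real.exp (-(2 * z) * Real.sinh (s / 2) ^ 2) * (Real.cosh (s / 2) / 2)) := fun s => by
    rw [show -z * Real.cosh s = -z + -(2 * z) * Real.sinh (s / 2) ^ 2 by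
      linear_combination -z * cosh_sub_one_eq s, Real.exp_add, one_div_mul_eq_div]
    ring
  have hint := integrableOn_exp_neg_mul_cosh_mul hz (by fun_prop) (abs_cosh_mul_le (1 / 2))
  unfold besselK
  simp only [hE] at hint ⊢
  rw [integral_const_mul]
  have h := integral_comp_mul_deriv_Ioi (f := fun s => Real.sinh (s / 2))
    (f' := fun s => Real.cosh (s / 2) / 2) (g := fun u => Real.exp (-(2 * z) * u ^ 2)) (a := 0)
    (by fun_prop) ?_ (fun s _ => ?_) (by fun_prop)
    (integrable_exp_neg_mul_sq hz2).integrableOn ?_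
  · simp only [Function.comp_def, zero_div, Real.sinh_zero, integral_gaussian_Ioi] at h
    rw [h]
    ring
  · refine tendsto_atTop_mono' _ ?_ (tendsto_id.atTop_div_const two_pos)
    filter_upwards [eventually_ge_atTop 0] with s hs
    exact Real.self_le_sinh_iff.2 (div_nonneg hs two_pos.le)
  · refine (((hasDerivAt_id s).div_const 2).sinh.congr_deriv ?_).hasDerivWithinAt
    simp only [id]
    ring
  · rw [integrableOn_Ici_iff_integrableOn_Ioi]
    have hc : 2 * Real.exp (-z) ≠ 0 := by positivity
    exact (integrable_const_mul_iff (isUnit_iff_ne_zero.2 hc) _).1 hint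

lemma abs_cosh_mul_sub_cosh_half_le (α s : ℝ) :
    |Real.cosh (α * s) - Real.cosh (1 / 2 * s)|
      ≤ (α ^ 2 + 1) * (s ^ 2 * Real.exp ((|α| + 1) * |s|)) := by
  have h1 := abs_cosh_sub_one_le (α * s)
  have h2 := abs_cosh_sub_one_le (1 / 2 * s)
  have h3 : Real.exp |α * s| ≤ Real.exp ((|α| + 1) * |s|) := by
    rw [abs_mul]
    gcongr
    linarith
  have h4 : Real.exp |1 / 2 * s| ≤ Real.exp ((|α| + 1) * |s|) := by
    rw [abs_mul, abs_of_pos (by norm_num)]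
    gcongr
    linarith [abs_nonneg α]
  have h5 := abs_sub_le (Real.cosh (α * s)) 1 (Real.cosh (1 / 2 * s))
  rw [abs_sub_comm 1] at h5
  have h6 := mul_le_mul_of_nonneg_left h3 (by positivity : 0 ≤ (α * s) ^ 2 / 2)
  have h7 := mul_le_mul_of_nonneg_left h4 (by positivity : 0 ≤ (1 / 2 * s) ^ 2 / 2)
  have h8 : 0 ≤ s ^ 2 * Real.exp ((|α| + 1) * |s|) := by positivity
  nlinarith [sq_nonneg α, mul_nonneg (sq_nonneg α) h8]

lemma exists_abs_besselK_sub_le (α : ℝ) : ∃ C : ℝ, ∀ z : ℝ, 1 ≤ z →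
    |besselK α z - besselK (1 / 2) z| ≤ C * (Real.exp (-z) * z ^ (-(3 / 2) : ℝ)) := by
  set M := |α| + 1
  refine ⟨(α ^ 2 + 1) * Real.exp (M ^ 2) *
    ((1 / 4) ^ (-(3 / 2) : ℝ) * (1 / 2) * Real.Gamma (3 / 2)), fun z hz => ?_⟩
  have hz0 : 0 < z := by linarith
  have hz4 : 0 < z / 4 := by positivity
  have hG : ∫ s in Ioi (0 : ℝ), s ^ (2 : ℝ) * Real.exp (-(z / 4) * s ^ (2 : ℝ))
      = z ^ (-(3 / 2) : ℝ) * ((1 / 4) ^ (-(3 / 2) : ℝ) * (1 / 2) * Real.Gamma (3 / 2)) := by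
    rw [integral_rpow_mul_exp_neg_mul_rpow two_pos (by norm_num) hz4, div_eq_mul_one_div z,
      Real.mul_rpow hz0.le (by norm_num)]
    norm_num
    ring
  have hGi := integrableOn_rpow_mul_exp_neg_mul_sq hz4 (by norm_num : (-1 : ℝ) < 2)
  simp only [Real.rpow_two] at hG hGi
  unfold besselK
  rw [← integral_sub (integrableOn_exp_neg_mul_cosh_mul hz0 (by fun_prop) (abs_cosh_mul_le α))
    (integrableOn_exp_neg_mul_cosh_mul hz0 (by fun_prop) (abs_cosh_mul_le (1 / 2)))]
  have hbd := norm_integral_le_of_norm_le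
    (f := fun s => Real.exp (-z * Real.cosh s) * Real.cosh (α * s)
      - Real.exp (-z * Real.cosh s) * Real.cosh (1 / 2 * s))
    (hGi.const_mul ((α ^ 2 + 1) * Real.exp (M ^ 2) * Real.exp (-z)))
    (Eventually.of_forall fun s => ?_)
  · rw [integral_const_mul, hG] at hbd
    exact hbd.trans_eq (by ring)
  · have h1 := abs_cosh_mul_sub_cosh_half_le α s
    have h2 : Real.exp (-z * Real.cosh s) * Real.exp (M * |s|)
        ≤ Real.exp (M ^ 2) * Real.exp (-z) * Real.exp (-(z / 4) * s ^ 2) := by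
      rw [← Real.exp_add, ← Real.exp_add, ← Real.exp_add, Real.exp_le_exp]
      have h3 := mul_le_mul_of_nonneg_left (one_add_sq_div_two_le_cosh s) hz0.le
      nlinarith [sq_nonneg (M - |s| / 2), sq_abs s, mul_nonneg (sub_nonneg.2 hz) (sq_nonneg s)]
    rw [Real.norm_eq_abs, ← mul_sub, abs_mul, abs_of_pos (Real.exp_pos _)]
    calc _ ≤ Real.exp (-z * Real.cosh s) * ((α ^ 2 + 1) * (s ^ 2 * Real.exp (M * |s|))) := by
          gcongr
      _ = (α ^ 2 + 1) * s ^ 2 * (Real.exp (-z * Real.cosh s) * Real.exp (M * |s|)) := by ring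
      _ ≤ (α ^ 2 + 1) * s ^ 2 *
          (Real.exp (M ^ 2) * Real.exp (-z) * Real.exp (-(z / 4) * s ^ 2)) := by gcongr
      _ = _ := by ring

lemma tendsToRate_tildeK (α : ℝ) :
    TendsToRate (fun x => x ^ (α + 1 / 2) * Real.exp x * tildeK α x)
      (2 ^ α * √(Real.pi / 2)) := by
  obtain ⟨C, hC⟩ := exists_abs_besselK_sub_le α
  refine TendsToRate.of_le (C := 2 ^ α * C) fun x hx => ?_
  have hx0 : 0 < x := by linarith
  have h := hC x hx
  rw [besselK_one_half hx0] at h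
  have h1 : x ^ (α + 1 / 2) * Real.exp x * tildeK α x
      = 2 ^ α * (√x * Real.exp x * besselK α x) := by
    rw [tildeK, Real.rpow_neg (by positivity), Real.div_rpow hx0.le two_pos.le,
      Real.rpow_add hx0, Real.sqrt_eq_rpow]
    field_simp
  have h2 : √x * Real.exp x * (Real.exp (-x) * √(Real.pi / (2 * x))) = √(Real.pi / 2) := by
    rw [show √x * Real.exp x * (Real.exp (-x) * √(Real.pi / (2 * x)))
      = √x * √(Real.pi / (2 * x)) * (Real.exp x * Real.exp (-x)) by ring, ← Real.exp_add,
      add_neg_cancel, Real.exp_zero, mul_one, ← Real.sqrt_mul hx0.le]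
    congr 1
    field_simp
  have h3 : √x * Real.exp x * (Real.exp (-x) * x ^ (-(3 / 2) : ℝ)) = 1 / x := by
    rw [show √x * Real.exp x * (Real.exp (-x) * x ^ (-(3 / 2) : ℝ))
      = √x * x ^ (-(3 / 2) : ℝ) * (Real.exp x * Real.exp (-x)) by ring, ← Real.exp_add,
      add_neg_cancel, Real.exp_zero, mul_one, Real.sqrt_eq_rpow, ← Real.rpow_add hx0, one_div x,
      ← Real.rpow_neg_one]
    norm_num
  have hp : 0 < 2 ^ α * (√x * Real.exp x) := by positivity
  have h4 := mul_le_mul_of_nonneg_left h hp.le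
  nth_rewrite 1 [← abs_of_pos hp] at h4
  rw [← abs_mul] at h4
  calc _ = |2 ^ α * (√x * Real.exp x) *
        (besselK α x - Real.exp (-x) * √(Real.pi / (2 * x)))| := by
        rw [h1, ← h2]
        congr 1
        ring
    _ ≤ _ := h4
    _ = 2 ^ α * C * (√x * Real.exp x * (Real.exp (-x) * x ^ (-(3 / 2) : ℝ))) := by ring
    _ = _ := by rw [h3, mul_one_div]

/-! ### The Taylor coefficients of the generating functions -/

lemma tildeI_zero (α : ℝ) : tildeI α 0 = (Real.Gamma (α + 1))⁻¹ := by
  rw [tildeI_eq_tildeISeries, tildeISeries, tsum_eq_single 0 fun n hn => by simp [hn]]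
  simp [tildeICoeff]

lemma exists_tendsToRate_iteratedDeriv_tildeI_genProd {μ : ℝ}
    (hμ : ∀ n : ℕ, μ ≠ -((n : ℝ) + 1)) {B : ℕ → ℝ → ℝ} {ε p b : ℝ} (hε : ε ^ 2 = 1) (hb : b ≠ 0)
    (hB : ∀ k z, 0 < z → HasDerivAt (B k) (ε * (z / 2) * B (k + 1) z) z)
    (hasymp : ∀ k : ℕ, TendsToRate
      (fun x => x ^ (p + k) * Real.exp (-(ε * x)) * B k x) (2 ^ k * b))
    (j : ℕ) (c : ℝ) :
    ∃ C : ℝ, C ≠ 0 ∧ TendsToRate (fun x => x ^ (p - j) * Real.exp (-(ε * x)) *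
      (iteratedDeriv j (genProd (tildeI (μ / 2)) (B 0) c x) 0 / j.factorial)) C := by
  have h0 : tildeI (μ / 2) 0 ≠ 0 := by
    rw [tildeI_zero]
    refine inv_ne_zero (Real.Gamma_ne_zero fun m hm => hμ (2 * m + 1) ?_)
    push_cast
    linarith
  have hne := twistedCoeff_ne_zero (β := μ / 2) hε (a := fun i => iteratedDeriv i (tildeI (μ / 2)) 0)
    (fun i => by simpa using tildeI_ode (μ / 2) i 0) (by simpa using h0)
    (fun n => by rw [mul_div_cancel₀ _ two_ne_zero]; exact hμ n) j
  have h := tendsToRate_iteratedDeriv_genProd (hasDerivAt_iteratedDeriv_tildeI (μ / 2))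
    hB hasymp j c 0 0
  have hj : (j.factorial : ℝ)⁻¹ ≠ 0 := by positivity
  refine ⟨_, mul_ne_zero hj (mul_ne_zero (mul_ne_zero (pow_ne_zero 0 two_ne_zero) hb) hne),
    (h.const_mul _).congr' fun x _ => ?_⟩
  rw [iteratedDeriv_zero, Nat.cast_zero, add_zero]
  ring

open Asymptotics in
/-- Asymptotic behavior of `Λ_{1,j}^{μ,ν}` and `Λ_{2,j}^{μ,ν}` as `x → ∞`, for
`μ ∉ {−1,−2,−3,…}`: there are nonzero constants `C₁, C₂` with
`Λ₁(x) = C₁·x^{j−(ν+1)/2}·eˣ·(1 + O(1/x))` and `Λ₂(x) = C₂·x^{j−(ν+1)/2}·e^{−x}·(1 + O(1/x))`. -/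
theorem statement8 (μ ν : ℝ) (hμ : ∀ n : ℕ, μ ≠ -((n : ℝ) + 1)) (j : ℕ) :
    ∃ C₁ C₂ : ℝ, C₁ ≠ 0 ∧ C₂ ≠ 0 ∧
      (fun x : ℝ => x ^ ((ν + 1) / 2 - (j : ℝ)) * Real.exp (-x) * Lambda₁ μ ν j x - C₁)
        =O[atTop] (fun x : ℝ => 1 / x) ∧
      (fun x : ℝ => x ^ ((ν + 1) / 2 - (j : ℝ)) * Real.exp x * Lambda₂ μ ν j x - C₂)
        =O[atTop] (fun x : ℝ => 1 / x) := by
  obtain ⟨b, hb, hI⟩ := exists_tendsToRate_tildeI (ν / 2)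
  have hK : ∀ k : ℕ, TendsToRate
      (fun x => x ^ (ν / 2 + 1 / 2 + k) * Real.exp (-(-1 * x)) * tildeK (ν / 2 + k) x)
      (2 ^ k * (2 ^ (ν / 2) * √(Real.pi / 2))) := fun k => by
    have h := tendsToRate_tildeK (ν / 2 + k)
    rw [Real.rpow_add two_pos, Real.rpow_natCast, mul_comm ((2 : ℝ) ^ (ν / 2)), mul_assoc] at h
    refine h.congr' fun x _ => ?_
    rw [add_right_comm, neg_one_mul, neg_neg]
  have hp : ν / 2 + 1 / 2 = (ν + 1) / 2 := by ring
  obtain ⟨C₁, hC₁, h₁⟩ := exists_tendsToRate_iteratedDeriv_tildeI_genProd hμ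
    (B := fun k => tildeI (ν / 2 + k)) (ε := 1) (by norm_num) hb
    (fun k z _ => by
      rw [one_mul, Nat.cast_succ, ← add_assoc]
      exact hasDerivAt_tildeI _ z)
    (fun k => by simpa only [one_mul] using hI k) j (-(μ + ν + 2) / 2)
  obtain ⟨C₂, hC₂, h₂⟩ := exists_tendsToRate_iteratedDeriv_tildeI_genProd hμ
    (B := fun k => tildeK (ν / 2 + k)) (ε := -1) (by norm_num) (by positivity)
    (fun k z hz => by
      rw [Nat.cast_succ, ← add_assoc]
      exact hasDerivAt_tildeK _ hz)
    hK j (-(μ + ν + 2) / 2)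
  simp only [Nat.cast_zero, add_zero, hp, one_mul, neg_one_mul, neg_neg] at h₁ h₂
  exact ⟨C₁, C₂, hC₁, hC₂, h₁, h₂⟩
end
end

section
/- Let μ ∈ ℝ with μ ∉ {−1,−2,−3,…}, let j ∈ ℕ₀ and x > 0. Then Λ_{1,j}^{μ,−1}(x) = (2^{μ−1}·Γ(j+(μ+1)/2)/(π·Γ(j+μ+1)))·(e^{−x}·L_j^μ(2x) + e^{x}·L_j^μ(−2x)) and Λ_{2,j}^{μ,−1}(x) = (2^{μ−1}·Γ(j+(μ+1)/2)/Γ(j+μ+1))·e^{−x}·L_j^μ(2x). -/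
noncomputable section

open Set MeasureTheory Filter Topology

/-- The Laguerre polynomial
`Lₙ^α(z) = ((α+1)ₙ/n!)·Σ_{k=0}^n binom(n,k)·((−1)^k/(α+1)ₖ)·z^k`. -/
def laguerreL (n : ℕ) (α : ℝ) (z : ℝ) : ℝ :=
  (ascPochhammer ℝ n).eval (α + 1) / (n.factorial : ℝ) *
    ∑ k ∈ Finset.range (n + 1),
      (n.choose k : ℝ) * ((-1) ^ k / (ascPochhammer ℝ k).eval (α + 1)) * z ^ k

lemma hasSum_one_sub_rpow_neg (a : ℝ) {t : ℝ} (ht : |t| < 1) :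
    HasSum (fun m : ℕ => (ascPochhammer ℝ m).eval a / (m.factorial : ℝ) * t ^ m)
      ((1 - t) ^ (-a)) := by
  have h := (Real.one_div_one_sub_rpow_hasFPowerSeriesOnBall_zero a).hasSum
    (y := t) (by simpa [enorm_eq_nnnorm, ← NNReal.coe_lt_one] using ht)
  have ht' : 0 ≤ 1 - t := by linarith [(abs_lt.mp ht).2]
  rw [Real.rpow_neg ht']
  convert! h using 1
  · funext m
    have hm : (m.factorial : ℝ) ≠ 0 := by positivity
    have h2 := Ring.factorial_nsmul_multichoose_eq_ascPochhammer a m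
    rw [Polynomial.ascPochhammer_smeval_eq_eval, nsmul_eq_mul, Ring.multichoose_eq] at h2
    rw [← h2, mul_div_cancel_left₀ _ hm]
    simp [FormalMultilinearSeries.ofScalars]
  · simp

lemma ascPochhammer_eval_add (a : ℝ) (k m : ℕ) :
    (ascPochhammer ℝ (k + m)).eval a =
      (ascPochhammer ℝ k).eval a * (ascPochhammer ℝ m).eval (a + k) := by
  rw [← ascPochhammer_mul]
  simp

lemma abs_ascPochhammer_eval_le {a b : ℝ} (h : |a| ≤ b) (m : ℕ) :
    |(ascPochhammer ℝ m).eval a| ≤ (ascPochhammer ℝ m).eval b := by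
  induction m with
  | zero => simp
  | succ m ih =>
    rw [ascPochhammer_succ_eval, ascPochhammer_succ_eval, abs_mul]
    have h1 : |a + m| ≤ b + m := by
      calc |a + m| ≤ |a| + |(m : ℝ)| := abs_add_le _ _
        _ ≤ b + m := by rw [Nat.abs_cast]; linarith
    exact mul_le_mul ih h1 (abs_nonneg _) ((abs_nonneg _).trans ih)

lemma Gamma_natCast_add {a : ℝ} (ha : ∀ n : ℕ, a ≠ -(n : ℝ)) (k : ℕ) :
    Real.Gamma ((k : ℝ) + a) = (ascPochhammer ℝ k).eval a * Real.Gamma a := by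
  induction k with
  | zero => simp
  | succ k ih =>
    have hk : (k : ℝ) + a ≠ 0 := fun h => ha k (by linarith)
    rw [ascPochhammer_succ_eval, show ((k + 1 : ℕ) : ℝ) + a = ((k : ℝ) + a) + 1 by push_cast; ring,
      Real.Gamma_add_one hk, ih]
    ring

lemma ascPochhammer_eval_ne_zero {a : ℝ} (ha : ∀ n : ℕ, a ≠ -(n : ℝ)) (k : ℕ) :
    (ascPochhammer ℝ k).eval a ≠ 0 := by
  induction k with
  | zero => simp
  | succ k ih =>
    rw [ascPochhammer_succ_eval]
    exact mul_ne_zero ih fun h => ha k (by linarith)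

lemma iteratedDeriv_div_factorial_of_hasSum {f : ℝ → ℝ} {b : ℕ → ℝ}
    (h : ∀ t : ℝ, |t| < 1 → HasSum (fun j => b j * t ^ j) (f t)) (j : ℕ) :
    iteratedDeriv j f 0 / (j.factorial : ℝ) = b j := by
  have h1 : HasFPowerSeriesAt f (FormalMultilinearSeries.ofScalars ℝ b) 0 := by
    rw [hasFPowerSeriesAt_iff]
    filter_upwards [Metric.ball_mem_nhds (0 : ℝ) one_pos] with t ht
    simpa [FormalMultilinearSeries.coeff_ofScalars, mul_comm] using h t (by simpa using ht)
  have h2 := congrArg (fun p => p.coeff j)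
    (h1.analyticAt.hasFPowerSeriesAt.eq_formalMultilinearSeries h1)
  simpa [FormalMultilinearSeries.coeff_ofScalars] using h2

/-- Rearrangement of `(1 - t)^(-c) * ∑ g_k (t / (1 - t))^k` into a power series in `t`. -/
lemma hasSum_one_sub_rpow_mul_tsum {g : ℕ → ℝ} (hg : ∀ w : ℝ, Summable fun k => ‖g k * w ^ k‖)
    (c : ℝ) {t : ℝ} (ht : |t| < 1) :
    HasSum (fun j => (∑ p ∈ Finset.HasAntidiagonal.antidiagonal j,
        g p.1 * ((ascPochhammer ℝ p.2).eval (c + p.1) / (p.2.factorial : ℝ))) * t ^ j)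
      ((1 - t) ^ (-c) * ∑' k, g k * (t / (1 - t)) ^ k) := by
  have ht1 : 0 < 1 - t := by linarith [(abs_lt.mp ht).2]
  have ht2 : 0 < 1 - |t| := by linarith
  set F : ℕ × ℕ → ℝ := fun p =>
    g p.1 * t ^ p.1 * ((ascPochhammer ℝ p.2).eval (c + p.1) / (p.2.factorial : ℝ) * t ^ p.2) with hF
  set B : ℕ × ℕ → ℝ := fun p => |g p.1| * |t| ^ p.1 *
    ((ascPochhammer ℝ p.2).eval (|c| + p.1) / (p.2.factorial : ℝ) * |t| ^ p.2) with hB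
  have hFB : ∀ p, ‖F p‖ ≤ B p := fun p => by
    simp only [hF, hB, Real.norm_eq_abs, abs_mul, abs_pow, abs_div, Nat.abs_cast]
    gcongr
    refine abs_ascPochhammer_eval_le ?_ _
    calc |c + p.1| ≤ |c| + |(p.1 : ℝ)| := abs_add_le _ _
      _ = _ := by rw [Nat.abs_cast]
  have hBk : ∀ k, HasSum (fun m => B (k, m))
      ((1 - |t|) ^ (-|c|) * ‖g k * (|t| / (1 - |t|)) ^ k‖) := fun k => by
    have h := (hasSum_one_sub_rpow_neg (|c| + k) (t := |t|) (by simpa using ht)).mul_left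
      (|g k| * |t| ^ k)
    convert! h using 1
    rw [norm_mul, norm_pow, Real.norm_eq_abs, Real.norm_of_nonneg (by positivity), neg_add,
      Real.rpow_add ht2, Real.rpow_neg ht2.le k, Real.rpow_natCast, div_pow]
    field_simp
  have hBs : Summable B := by
    rw [summable_prod_of_nonneg (fun p => (norm_nonneg _).trans (hFB p))]
    refine ⟨fun k => (hBk k).summable, ?_⟩
    simp_rw [fun k => (hBk k).tsum_eq]
    exact (hg _).mul_left _
  have hFs : Summable F := hBs.of_norm_bounded hFB
  have hFk : ∀ k, HasSum (fun m => F (k, m)) ((1 - t) ^ (-c) * (g k * (t / (1 - t)) ^ k)) :=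
    fun k => by
    have h := (hasSum_one_sub_rpow_neg (c + k) ht).mul_left (g k * t ^ k)
    convert! h using 1
    rw [neg_add, Real.rpow_add ht1, Real.rpow_neg ht1.le k, Real.rpow_natCast, div_pow]
    field_simp
  have hS := (hFs.hasSum.prod_fiberwise hFk).unique ((hg _).of_norm.hasSum.mul_left _)
  rw [← hS]
  have h1 := (Finset.HasAntidiagonal.sigmaAntidiagonalEquivProd (A := ℕ)).hasSum_iff.mpr hFs.hasSum
  refine h1.sigma fun j => ?_
  have h2 := hasSum_fintype fun p : Finset.HasAntidiagonal.antidiagonal j => F p.1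
  convert! h2 using 1
  rw [Finset.sum_coe_sort (Finset.HasAntidiagonal.antidiagonal j) F, Finset.sum_mul]
  refine Finset.sum_congr rfl fun p hp => ?_
  rw [← Finset.HasAntidiagonal.mem_antidiagonal.mp hp, pow_add]
  simp only [hF]
  ring

lemma four_pow_mul_factorial_mul_Gamma_add_half (n : ℕ) :
    4 ^ n * (n.factorial : ℝ) * Real.Gamma (n + 1 / 2) = ((2 * n).factorial : ℝ) * √Real.pi := by
  induction n with
  | zero => simpa using Real.Gamma_one_half_eq
  | succ n ih =>
    have h : (n : ℝ) + 1 / 2 ≠ 0 := by positivity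
    rw [show ((n + 1 : ℕ) : ℝ) + 1 / 2 = (n + 1 / 2) + 1 by push_cast; ring, Real.Gamma_add_one h,
      show 2 * (n + 1) = 2 * n + 1 + 1 by ring]
    simp only [Nat.factorial_succ]
    push_cast
    linear_combination (4 * (n + 1) * (n + 1 / 2) : ℝ) * ih

lemma tildeI_neg_half (z : ℝ) : tildeI (-1 / 2) z = Real.cosh z / √Real.pi := by
  rw [tildeI, ← ((Real.hasSum_cosh z).div_const _).tsum_eq]
  refine tsum_congr fun n => ?_
  have h := four_pow_mul_factorial_mul_Gamma_add_half n
  rw [show (n : ℝ) + -1 / 2 + 1 = n + 1 / 2 by ring, div_pow, div_div, div_div, ← h, pow_mul 2]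
  norm_num [mul_assoc]

lemma besselK_neg_half (z : ℝ) :
    besselK (-1 / 2) z = Real.exp (-z) * √(Real.pi / (2 * z)) := by
  have himg : (fun s : ℝ => Real.sinh (s / 2)) '' Ioi 0 = Ioi 0 := by
    ext y
    constructor
    · rintro ⟨s, hs, rfl⟩
      exact Real.sinh_pos_iff.mpr (half_pos hs)
    · intro hy
      exact ⟨2 * Real.arsinh y, mul_pos two_pos (Real.arsinh_pos_iff.mpr hy), by simp⟩
  have h := integral_image_eq_integral_deriv_smul_of_monotoneOn (s := Ioi (0 : ℝ))
    (f := fun s => Real.sinh (s / 2)) (f' := fun s => Real.cosh (s / 2) * (1 / 2))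
    measurableSet_Ioi
    (fun s _ => (((hasDerivAt_id s).div_const 2).sinh).hasDerivWithinAt)
    (fun a _ b _ hab => Real.sinh_le_sinh.mpr (by linarith))
    (fun u => 2 * Real.exp (-z) * Real.exp (-(2 * z) * u ^ 2))
  rw [himg, integral_const_mul, integral_gaussian_Ioi] at h
  rw [besselK]
  calc _ = _ := integral_congr_ae (ae_of_all _ fun s => ?_)
    _ = _ := h.symm
    _ = _ := by ring
  have h1 : Real.cosh s = 1 + 2 * Real.sinh (s / 2) ^ 2 := by
    have := Real.cosh_two_mul (s / 2)
    rw [Real.cosh_sq, mul_div_cancel₀ _ two_ne_zero] at this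
    rw [this]; ring
  rw [h1, show -1 / 2 * s = -(s / 2) by ring, Real.cosh_neg, smul_eq_mul,
    show -z * (1 + 2 * Real.sinh (s / 2) ^ 2) = -z + -(2 * z) * Real.sinh (s / 2) ^ 2 by ring,
    Real.exp_add]
  ring

lemma tildeK_neg_half {z : ℝ} (hz : 0 < z) :
    tildeK (-1 / 2) z = √Real.pi / 2 * Real.exp (-z) := by
  rw [tildeK, besselK_neg_half z, show -(-1 / 2 : ℝ) = 1 / 2 by norm_num, ← Real.sqrt_eq_rpow,
    mul_left_comm, ← Real.sqrt_mul (by positivity),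
    show z / 2 * (Real.pi / (2 * z)) = Real.pi / 2 ^ 2 by field_simp,
    Real.sqrt_div' _ (by positivity), Real.sqrt_sq (by norm_num), mul_comm]

/-- The coefficient of `w ^ k` in `tildeI α w`. -/
def besselCoeff (α : ℝ) (k : ℕ) : ℝ :=
  if Even k then 1 / (2 ^ k * ((k / 2).factorial : ℝ) * Real.Gamma (((k / 2 : ℕ) : ℝ) + α + 1))
  else 0

lemma besselCoeff_two_mul (α : ℝ) (n : ℕ) :
    besselCoeff α (2 * n) = 1 / (2 ^ (2 * n) * (n.factorial : ℝ) * Real.Gamma ((n : ℝ) + α + 1)) := by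
  simp [besselCoeff]

lemma besselCoeff_two_mul_add_one (α : ℝ) (n : ℕ) : besselCoeff α (2 * n + 1) = 0 := by
  simp [besselCoeff]

lemma besselCoeff_add_two {α : ℝ} (hα : ∀ n : ℕ, α + 1 ≠ -(n : ℝ)) (k : ℕ) :
    ((k : ℝ) + 2) * (k + 2 + 2 * α) * besselCoeff α (k + 2) = besselCoeff α k := by
  obtain ⟨n, rfl | rfl⟩ := Nat.even_or_odd' k
  · have h0 : (n : ℝ) + α + 1 ≠ 0 := fun h => hα n (by linarith)
    rw [show 2 * n + 2 = 2 * (n + 1) by ring, besselCoeff_two_mul, besselCoeff_two_mul,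
      show ((n + 1 : ℕ) : ℝ) + α + 1 = (n + α + 1) + 1 by push_cast; ring, Real.Gamma_add_one h0,
      Nat.factorial_succ]
    have h1 : Real.Gamma (n + α + 1) ≠ 0 := Real.Gamma_ne_zero fun m h => hα (n + m) (by
      push_cast; linarith)
    have h2 : (n.factorial : ℝ) ≠ 0 := by positivity
    have h3 : (n : ℝ) + 1 ≠ 0 := by positivity
    push_cast
    rw [show 2 * (n + 1) = 2 * n + 2 by ring, pow_add]
    field_simp
    ring
  · rw [show 2 * n + 1 + 2 = 2 * (n + 1) + 1 by ring, besselCoeff_two_mul_add_one,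
      besselCoeff_two_mul_add_one, mul_zero]

lemma summable_norm_tildeI {α : ℝ} (hα : ∀ n : ℕ, α + 1 ≠ -(n : ℝ)) (w : ℝ) :
    Summable fun n => ‖besselCoeff α (2 * n) * w ^ (2 * n)‖ := by
  suffices h : Summable fun n => besselCoeff α (2 * n) * w ^ (2 * n) from h.norm
  refine summable_of_ratio_norm_eventually_le (r := 1 / 2) (by norm_num) ?_
  have h1 : ∀ᶠ n : ℕ in atTop, w ^ 2 + 1 + |α| ≤ n :=
    tendsto_natCast_atTop_atTop.eventually_ge_atTop _
  filter_upwards [h1] with n hn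
  have h2 := besselCoeff_add_two hα (2 * n)
  rw [← h2, show 2 * (n + 1) = 2 * n + 2 by ring, pow_add]
  have h3 := neg_abs_le α
  have h4 : (0 : ℝ) ≤ n := n.cast_nonneg
  have h5 : 2 * w ^ 2 ≤ ((2 * n : ℕ) + 2) * ((2 * n : ℕ) + 2 + 2 * α) := by
    push_cast
    nlinarith [sq_nonneg w]
  simp only [norm_mul]
  rw [← norm_mul ((2 * n : ℕ) + 2 : ℝ), Real.norm_of_nonneg (le_trans (by positivity) h5),
    Real.norm_of_nonneg (sq_nonneg w)]
  nlinarith [mul_nonneg (norm_nonneg (besselCoeff α (2 * n + 2))) (norm_nonneg (w ^ (2 * n)))]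

lemma hasSum_besselCoeff {α : ℝ} (hα : ∀ n : ℕ, α + 1 ≠ -(n : ℝ)) (w : ℝ) :
    HasSum (fun k => besselCoeff α k * w ^ k) (tildeI α w) := by
  have h1 : HasSum (fun n => besselCoeff α (2 * n) * w ^ (2 * n)) (tildeI α w) := by
    rw [tildeI]
    convert! (summable_norm_tildeI hα w).of_norm.hasSum using 1
    refine tsum_congr fun n => ?_
    rw [besselCoeff_two_mul, div_pow, div_div, div_mul_eq_mul_div, one_mul, mul_assoc]
  simpa using h1.even_add_odd (f := fun k => besselCoeff α k * w ^ k) (m' := 0)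
    (by simp [besselCoeff_two_mul_add_one, hasSum_zero])

lemma summable_norm_besselCoeff {α : ℝ} (hα : ∀ n : ℕ, α + 1 ≠ -(n : ℝ)) (w : ℝ) :
    Summable fun k => ‖besselCoeff α k * w ^ k‖ := (hasSum_besselCoeff hα w).summable.norm

/-- The coefficient of `w ^ k` in `exp (-w) * tildeI α w`. -/
def expBesselCoeff (α : ℝ) (k : ℕ) : ℝ :=
  ∑ p ∈ Finset.HasAntidiagonal.antidiagonal k,
    besselCoeff α p.1 * ((-1) ^ p.2 / (p.2.factorial : ℝ))

lemma expBesselCoeff_succ {α : ℝ} (hα : ∀ n : ℕ, α + 1 ≠ -(n : ℝ)) (k : ℕ) :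
    ((k : ℝ) + 1) * (k + (2 * α + 1)) * expBesselCoeff α (k + 1) =
      -2 * (k + (α + 1 / 2)) * expBesselCoeff α k := by
  obtain ⟨a, ha⟩ : ∃ a, 2 * α + 1 = a := ⟨_, rfl⟩
  set D := PowerSeries.derivative ℝ
  set f : PowerSeries ℝ := PowerSeries.mk (besselCoeff α)
  set E : PowerSeries ℝ := PowerSeries.mk fun n => (-1) ^ n / (n.factorial : ℝ)
  have hE : D E = -E := by
    ext n
    simp only [D, E, PowerSeries.coeff_derivative, PowerSeries.coeff_mk, map_neg, pow_succ,
      Nat.factorial_succ]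
    push_cast
    field_simp
  have hf : PowerSeries.X * D (D f) + PowerSeries.C a * D f = PowerSeries.X * f := by
    ext n
    rcases n with _ | n
    · simp only [map_add, PowerSeries.coeff_zero_X_mul, PowerSeries.coeff_C_mul, D, f,
        PowerSeries.coeff_derivative, PowerSeries.coeff_mk]
      simp [besselCoeff]
    · simp only [map_add, PowerSeries.coeff_succ_X_mul, PowerSeries.coeff_C_mul, D, f,
        PowerSeries.coeff_derivative, PowerSeries.coeff_mk]
      rw [← besselCoeff_add_two hα n, ← ha]
      push_cast
      ring
  have hD1 : D (f * E) = (D f - f) * E := by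
    rw [Derivation.leibniz, hE, smul_eq_mul, smul_eq_mul]; ring
  have hD2 : D (D (f * E)) = (D (D f) - 2 * D f + f) * E := by
    rw [hD1, Derivation.leibniz, hE, smul_eq_mul, smul_eq_mul, map_sub]; ring
  have key : PowerSeries.X * D (D (f * E)) + PowerSeries.X * D (f * E)
      + PowerSeries.X * D (f * E) + PowerSeries.C a * D (f * E) + PowerSeries.C a * (f * E) = 0 := by
    rw [hD2, hD1]
    linear_combination E * hf
  have hc : ∀ n, PowerSeries.coeff n (f * E) = expBesselCoeff α n := fun n => by
    simp [PowerSeries.coeff_mul, f, E, expBesselCoeff]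
  have h := congrArg (PowerSeries.coeff k) key
  rcases k with _ | k
  · simp only [map_add, PowerSeries.coeff_zero_X_mul, PowerSeries.coeff_C_mul, D,
        PowerSeries.coeff_derivative, hc, map_zero] at h
    rw [← ha] at h
    push_cast at h ⊢
    linear_combination h
  · simp only [map_add, PowerSeries.coeff_succ_X_mul, PowerSeries.coeff_C_mul, D,
        PowerSeries.coeff_derivative, hc, map_zero] at h
    rw [← ha] at h
    push_cast at h ⊢
    linear_combination h

/-- Kummer's second formula, at the level of coefficients. -/
lemma expBesselCoeff_eq {α : ℝ} (hα : ∀ n : ℕ, α + 1 ≠ -(n : ℝ))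
    (hα' : ∀ n : ℕ, 2 * α + 1 ≠ -(n : ℝ)) (k : ℕ) :
    expBesselCoeff α k = (-2) ^ k * (ascPochhammer ℝ k).eval (α + 1 / 2) /
      ((ascPochhammer ℝ k).eval (2 * α + 1) * (k.factorial : ℝ)) / Real.Gamma (α + 1) := by
  induction k with
  | zero => simp [expBesselCoeff, besselCoeff]
  | succ k ih =>
    have h := expBesselCoeff_succ hα k
    have h1 : (k : ℝ) + (2 * α + 1) ≠ 0 := fun h => hα' k (by linarith)
    have h2 : (2 * α + 1) + (k : ℝ) ≠ 0 := by rwa [add_comm]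
    have h3 : (k : ℝ) + 1 ≠ 0 := by positivity
    rw [ih, mul_comm, ← eq_div_iff (mul_ne_zero h3 h1)] at h
    rw [h, ascPochhammer_succ_eval, ascPochhammer_succ_eval, Nat.factorial_succ, pow_succ]
    have h4 := ascPochhammer_eval_ne_zero hα' k
    have h5 : Real.Gamma (α + 1) ≠ 0 := Real.Gamma_ne_zero hα
    push_cast
    rw [add_comm (k : ℝ) (2 * α + 1), add_comm (k : ℝ) (α + 1 / 2)]
    field_simp

lemma expBesselCoeff_mul_pow (α w : ℝ) (k : ℕ) :
    expBesselCoeff α k * w ^ k = ∑ p ∈ Finset.HasAntidiagonal.antidiagonal k,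
      (besselCoeff α p.1 * w ^ p.1) * ((-w) ^ p.2 / (p.2.factorial : ℝ)) := by
  rw [expBesselCoeff, Finset.sum_mul]
  refine Finset.sum_congr rfl fun p hp => ?_
  rw [← Finset.HasAntidiagonal.mem_antidiagonal.mp hp, pow_add, neg_pow w]
  ring

lemma summable_norm_expBesselCoeff {α : ℝ} (hα : ∀ n : ℕ, α + 1 ≠ -(n : ℝ)) (w : ℝ) :
    Summable fun k => ‖expBesselCoeff α k * w ^ k‖ := by
  simp_rw [expBesselCoeff_mul_pow]
  exact summable_norm_sum_mul_antidiagonal_of_summable_norm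
    (f := fun k => besselCoeff α k * w ^ k) (g := fun k => (-w) ^ k / (k.factorial : ℝ))
    (summable_norm_besselCoeff hα w) (Real.summable_pow_div_factorial (-w)).norm

lemma tsum_expBesselCoeff {α : ℝ} (hα : ∀ n : ℕ, α + 1 ≠ -(n : ℝ)) (w : ℝ) :
    ∑' k, expBesselCoeff α k * w ^ k = tildeI α w * Real.exp (-w) := by
  simp_rw [expBesselCoeff_mul_pow]
  rw [← tsum_mul_tsum_eq_tsum_sum_antidiagonal_of_summable_norm
    (f := fun k => besselCoeff α k * w ^ k) (g := fun k => (-w) ^ k / (k.factorial : ℝ))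
    (summable_norm_besselCoeff hα w) (Real.summable_pow_div_factorial (-w)).norm,
    (hasSum_besselCoeff hα w).tsum_eq,
    Real.exp_eq_exp_ℝ, (NormedSpace.expSeries_div_hasSum_exp (-w)).tsum_eq]

lemma sum_antidiagonal_expBesselCoeff {α : ℝ} (hα : ∀ n : ℕ, α + 1 ≠ -(n : ℝ))
    (hα' : ∀ n : ℕ, 2 * α + 1 ≠ -(n : ℝ)) (y : ℝ) (j : ℕ) :
    ∑ p ∈ Finset.HasAntidiagonal.antidiagonal j, expBesselCoeff α p.1 * y ^ p.1 *
        ((ascPochhammer ℝ p.2).eval (α + 1 / 2 + p.1) / (p.2.factorial : ℝ)) =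
      (ascPochhammer ℝ j).eval (α + 1 / 2) /
        ((ascPochhammer ℝ j).eval (2 * α + 1) * Real.Gamma (α + 1)) *
        laguerreL j (2 * α) (2 * y) := by
  have hj := ascPochhammer_eval_ne_zero hα' j
  have hG : Real.Gamma (α + 1) ≠ 0 := Real.Gamma_ne_zero hα
  rw [laguerreL, ← Finset.Nat.sum_antidiagonal_eq_sum_range_succ_mk
    (fun p => (j.choose p.1 : ℝ) * ((-1) ^ p.1 / (ascPochhammer ℝ p.1).eval (2 * α + 1)) *
      (2 * y) ^ p.1), Finset.mul_sum, Finset.mul_sum]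
  refine Finset.sum_congr rfl fun p hp => ?_
  obtain ⟨k, m⟩ := p
  obtain rfl : k + m = j := Finset.HasAntidiagonal.mem_antidiagonal.mp hp
  have hk := ascPochhammer_eval_ne_zero hα' k
  have h1 : ((k + m).choose k : ℝ) = ((k + m).factorial : ℝ) / (k.factorial * m.factorial) :=
    Nat.cast_add_choose ℝ
  have h2 : ((k + m).factorial : ℝ) ≠ 0 := by positivity
  have h3 : (k.factorial : ℝ) ≠ 0 := by positivity
  have h4 : (m.factorial : ℝ) ≠ 0 := by positivity
  have h5 : (-2 : ℝ) ^ k = (-1) ^ k * 2 ^ k := by rw [← mul_pow]; norm_num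
  simp only [expBesselCoeff_eq hα hα', h1, ascPochhammer_eval_add (α + 1 / 2), h5, mul_pow]
  generalize (ascPochhammer ℝ k).eval (2 * α + 1) = a at hk ⊢
  generalize (ascPochhammer ℝ (k + m)).eval (2 * α + 1) = b at hj ⊢
  field_simp

lemma ascPochhammer_div_eq_Gamma {α : ℝ} (hα : ∀ n : ℕ, α + 1 ≠ -(n : ℝ))
    (hα' : ∀ n : ℕ, 2 * α + 1 ≠ -(n : ℝ)) (j : ℕ) :
    (ascPochhammer ℝ j).eval (α + 1 / 2) /
        ((ascPochhammer ℝ j).eval (2 * α + 1) * Real.Gamma (α + 1)) =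
      2 ^ (2 * α) * Real.Gamma (j + (α + 1 / 2)) / (√Real.pi * Real.Gamma (j + (2 * α + 1))) := by
  have hc : ∀ n : ℕ, α + 1 / 2 ≠ -(n : ℝ) := fun n h => hα' (2 * n) (by push_cast; linarith)
  have h := Real.Gamma_mul_Gamma_add_half (α + 1 / 2)
  rw [show α + 1 / 2 + 1 / 2 = α + 1 by ring, show 2 * (α + 1 / 2) = 2 * α + 1 by ring,
    show 1 - (2 * α + 1) = -(2 * α) by ring, Real.rpow_neg two_pos.le] at h
  rw [Gamma_natCast_add hc, Gamma_natCast_add hα']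
  have h1 := ascPochhammer_eval_ne_zero hα' j
  have h2 : Real.Gamma (α + 1) ≠ 0 := Real.Gamma_ne_zero hα
  have h3 : Real.Gamma (2 * α + 1) ≠ 0 := Real.Gamma_ne_zero hα'
  have h4 : √Real.pi ≠ 0 := by positivity
  have h5 : (2 : ℝ) ^ (2 * α) ≠ 0 := by positivity
  generalize (ascPochhammer ℝ j).eval (2 * α + 1) = a at h1 ⊢
  generalize (ascPochhammer ℝ j).eval (α + 1 / 2) = b
  generalize Real.Gamma (2 * α + 1) = u at h h3 ⊢
  generalize Real.Gamma (α + 1 / 2) = v at h ⊢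
  generalize (2 : ℝ) ^ (2 * α) = w at h h5 ⊢
  field_simp at h ⊢
  linear_combination -b * h

lemma hasSum_laguerreL {μ : ℝ} (hμ : ∀ n : ℕ, μ ≠ -((n : ℝ) + 1)) (y : ℝ) {t : ℝ}
    (ht : |t| < 1) :
    HasSum (fun j : ℕ => 2 ^ μ * Real.Gamma (j + (μ + 1) / 2) /
        (√Real.pi * Real.Gamma (j + μ + 1)) * (Real.exp (-y) * laguerreL j μ (2 * y)) * t ^ j)
      ((1 - t) ^ (-(μ + 1) / 2) * tildeI (μ / 2) (t * y / (1 - t)) *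
        Real.exp (-(y / (1 - t)))) := by
  have hα : ∀ n : ℕ, μ / 2 + 1 ≠ -(n : ℝ) := fun n h => hμ (2 * n + 1) (by push_cast; linarith)
  have hα' : ∀ n : ℕ, 2 * (μ / 2) + 1 ≠ -(n : ℝ) := fun n h => hμ n (by linarith)
  have ht1 : 1 - t ≠ 0 := by linarith [(abs_lt.mp ht).2]
  have hg : ∀ w : ℝ, Summable fun k => ‖expBesselCoeff (μ / 2) k * y ^ k * w ^ k‖ := fun w => by
    simpa only [mul_assoc, mul_pow] using summable_norm_expBesselCoeff hα (y * w)
  have h := (hasSum_one_sub_rpow_mul_tsum hg (μ / 2 + 1 / 2) ht).mul_left (Real.exp (-y))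
  convert! h using 1
  · funext j
    rw [sum_antidiagonal_expBesselCoeff hα hα', ascPochhammer_div_eq_Gamma hα hα',
      mul_div_cancel₀ μ two_ne_zero, show μ / 2 + 1 / 2 = (μ + 1) / 2 by ring, ← add_assoc]
    ring
  · have h1 := tsum_expBesselCoeff hα (t * y / (1 - t))
    rw [show -(y / (1 - t)) = -y + -(t * y / (1 - t)) by field_simp; ring, Real.exp_add,
      show -(μ + 1) / 2 = -(μ / 2 + 1 / 2) by ring,
      tsum_congr fun k => show expBesselCoeff (μ / 2) k * y ^ k * (t / (1 - t)) ^ k =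
        expBesselCoeff (μ / 2) k * (t * y / (1 - t)) ^ k by
          rw [mul_assoc, ← mul_pow]; congr 2; ring, h1]
    ring

lemma tildeI_neg (α z : ℝ) : tildeI α (-z) = tildeI α z := by
  simp only [tildeI, pow_mul, neg_div, neg_sq]

/-- For `μ ∉ {−1,−2,−3,…}` and `ν = −1` the functions `Λ_{1,j}^{μ,−1}` and `Λ_{2,j}^{μ,−1}`
are given explicitly in terms of Laguerre polynomials. -/
theorem statement13 (μ : ℝ) (hμ : ∀ n : ℕ, μ ≠ -((n : ℝ) + 1)) (j : ℕ) (x : ℝ) (hx : 0 < x) :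
    Lambda₁ μ (-1) j x
      = 2 ^ (μ - 1) * Real.Gamma ((j : ℝ) + (μ + 1) / 2) /
          (Real.pi * Real.Gamma ((j : ℝ) + μ + 1)) *
        (Real.exp (-x) * laguerreL j μ (2 * x) + Real.exp x * laguerreL j μ (-(2 * x))) ∧
    Lambda₂ μ (-1) j x
      = 2 ^ (μ - 1) * Real.Gamma ((j : ℝ) + (μ + 1) / 2) / Real.Gamma ((j : ℝ) + μ + 1) *
        (Real.exp (-x) * laguerreL j μ (2 * x)) := by
  have hpi : √Real.pi * √Real.pi = Real.pi := Real.mul_self_sqrt Real.pi_pos.le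
  have hpi0 : √Real.pi ≠ 0 := by positivity
  have h2 : (2 : ℝ) ^ (μ - 1) = 2 ^ μ / 2 := by rw [Real.rpow_sub_one two_ne_zero]
  constructor
  · rw [Lambda₁]
    refine (iteratedDeriv_div_factorial_of_hasSum
      (b := fun j => 1 / (2 * √Real.pi) * (2 ^ μ * Real.Gamma (j + (μ + 1) / 2) /
        (√Real.pi * Real.Gamma (j + μ + 1)) * (Real.exp (-x) * laguerreL j μ (2 * x)) +
        2 ^ μ * Real.Gamma (j + (μ + 1) / 2) /
        (√Real.pi * Real.Gamma (j + μ + 1)) * (Real.exp x * laguerreL j μ (-(2 * x)))))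
      (fun t ht => ?_) j).trans ?_
    · have h := ((hasSum_laguerreL hμ x ht).add (hasSum_laguerreL hμ (-x) ht)).mul_left
        (1 / (2 * √Real.pi))
      convert! h using 1
      · funext j
        simp only [neg_neg, mul_neg]
        ring
      · rw [genG₁, tildeI_neg_half, Real.cosh_eq,
          show -(μ + -1 + 2) / 2 = -(μ + 1) / 2 by ring,
          show t * -x / (1 - t) = -(t * x / (1 - t)) by ring, tildeI_neg,
          show -(-x / (1 - t)) = x / (1 - t) by ring]
        ring
    · generalize √Real.pi = s at hpi hpi0 ⊢
      rw [h2, ← hpi]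
      field_simp
  · rw [Lambda₂]
    refine (iteratedDeriv_div_factorial_of_hasSum
      (b := fun j => √Real.pi / 2 * (2 ^ μ * Real.Gamma (j + (μ + 1) / 2) /
        (√Real.pi * Real.Gamma (j + μ + 1)) * (Real.exp (-x) * laguerreL j μ (2 * x))))
      (fun t ht => ?_) j).trans ?_
    · have h := (hasSum_laguerreL hμ x ht).mul_left (√Real.pi / 2)
      have ht1 : 0 < 1 - t := by linarith [(abs_lt.mp ht).2]
      convert! h using 1
      · funext j
        ring
      · rw [genG₂, tildeK_neg_half (div_pos hx ht1),
          show -(μ + -1 + 2) / 2 = -(μ + 1) / 2 by ring]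
        ring
    · rw [h2]
      field_simp
end
end
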